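/- Let p be an odd prime and K a finite field extension of ℚ_p. Let Q₀ be an anisotropic quadratic form of even degree d over K, and let b ≥ 0 be an integer. Let N be the number of b-tuples (c₁,…,c_b), where each c_i is an isometry class of nondegenerate quadratic forms of degree 2 over K, such that the orthogonal sum of representatives of the c_i is Witt equivalent to Q₀. Then, as integers, N = (7^b − (−1)^b)/8 + ε, where ε = 1 if d = 0 and b is even, ε = −1 if d = 4 and b is odd, and ε = 0 otherwise. -/

import Mathlib

/-- A quadratic form of degree `m` over `K`: a quadratic form on `Fin m → K`. -/
abbrev QF (K : Type) [Field K] (m : ℕ) : Type := QuadraticForm K (Fin m → K)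

/-- Two quadratic forms are isometric if there is a linear equivalence of the underlying
spaces carrying one to the other. -/
def QIsom {K : Type} [Field K] {M M' : Type} [AddCommGroup M] [Module K M]
    [AddCommGroup M'] [Module K M'] (Q : QuadraticForm K M) (Q' : QuadraticForm K M') : Prop :=
  ∃ φ : M ≃ₗ[K] M', ∀ x, Q' (φ x) = Q x

/-- The hyperbolic plane `(x, y) ↦ x * y` on `K²`. -/
noncomputable def HypForm (K : Type) [Field K] : QuadraticForm K (K × K) :=
  QuadraticMap.linMulLin (LinearMap.fst K K K) (LinearMap.snd K K K)

/-- Orthogonal sum of `m` copies of the hyperbolic plane. -/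
noncomputable def HypSum (K : Type) [Field K] (m : ℕ) : QuadraticForm K (Fin m → K × K) :=
  QuadraticMap.pi (fun _ : Fin m => HypForm K)

/-- Witt equivalence of quadratic forms. -/
def WittEquiv {K : Type} [Field K] {M M' : Type} [AddCommGroup M] [Module K M]
    [AddCommGroup M'] [Module K M'] (Q : QuadraticForm K M) (Q' : QuadraticForm K M') : Prop :=
  ∃ a b : ℕ, QIsom (Q.prod (HypSum K a)) (Q'.prod (HypSum K b))

/-- A quadratic form is nondegenerate if its polar bilinear form is nondegenerate. -/
def QNondeg {K : Type} [Field K] {M : Type} [AddCommGroup M] [Module K M]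
    (Q : QuadraticForm K M) : Prop :=
  ∀ v, (∀ w, QuadraticMap.polar (⇑Q) v w = 0) → v = 0

/-- The diagonal quadratic form `⟨a₁, …, a_m⟩`. -/
noncomputable def diagQF {K : Type} [Field K] {m : ℕ} (r : Fin m → Kˣ) : QF K m :=
  QuadraticMap.weightedSumSquares K (fun i => (r i : K))

/-- The Lie algebra `so(Q)`. -/
def soSet {K : Type} [Field K] {M : Type} [AddCommGroup M] [Module K M]
    (Q : QuadraticForm K M) : Set (Module.End K M) :=
  {X | ∀ v w, QuadraticMap.polar (⇑Q) (X v) w + QuadraticMap.polar (⇑Q) v (X w) = 0}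

/-- Membership in the orthogonal group `O(Q)` (as invertible linear maps preserving `Q`). -/
def InO {K : Type} [Field K] {M : Type} [AddCommGroup M] [Module K M]
    (Q : QuadraticForm K M) (g : M ≃ₗ[K] M) : Prop :=
  ∀ v, Q (g v) = Q v

/-- Membership in the special orthogonal group `SO(Q)`. -/
def InSO {K : Type} [Field K] {M : Type} [AddCommGroup M] [Module K M]
    (Q : QuadraticForm K M) (g : M ≃ₗ[K] M) : Prop :=
  InO Q g ∧ LinearMap.det (g : M →ₗ[K] M) = 1

/-- A nilpotent endomorphism has Jordan type `λ` when `dim ker (X^i) = Σ_j min(i, λ_j)`. -/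
def HasJordanType {K : Type} [Field K] {M : Type} [AddCommGroup M] [Module K M]
    {n : ℕ} (X : Module.End K M) (lam : Nat.Partition n) : Prop :=
  ∀ i : ℕ, Module.finrank K (LinearMap.ker (X ^ i)) = (lam.parts.map (fun part => min i part)).sum

/-- `Λ(n)`: partitions of `n` in which every even part has even multiplicity. -/
def LambdaSet (n : ℕ) : Set (Nat.Partition n) :=
  {lam | ∀ j : ℕ, Even j → Even (lam.parts.count j)}



section LocalPart
open scoped NormedField Valued

lemma loc_sq {K : Type*} [NontriviallyNormedField K] [IsUltrametricDist K] [ProperSpace K]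
    (h2 : ‖(2 : K)‖ = 1) (x : K) (hx : ‖x - 1‖ < 1) : IsSquare x := by
  set r := ‖x - 1‖ with hr
  have hc : IsCompact (Metric.closedBall (1 : K) r) := isCompact_closedBall 1 r
  obtain ⟨y, hy, hmin⟩ := hc.exists_isMinOn (f := fun y => ‖y ^ 2 - x‖)
    ⟨1, by simp [hr]⟩ (by fun_prop)
  have hmr : ‖y ^ 2 - x‖ ≤ r := by
    have := hmin (a := 1) (by simp [hr])
    simp only [Set.mem_ofPred_eq, one_pow] at this
    rwa [norm_sub_rev 1 x] at this
  have hy1 : ‖y - 1‖ ≤ r := by simpa [dist_eq_norm] using hy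
  have hyn : ‖y‖ = 1 := by
    have := IsUltrametricDist.norm_add_eq_max_of_norm_ne_norm (x := y - 1) (y := 1) (by simp; linarith)
    simp at this; rw [this]; simp; linarith
  by_cases h0 : y ^ 2 - x = 0
  · exact ⟨y, by linear_combination -h0⟩
  exfalso
  have hy0 : y ≠ 0 := by intro h; simp [h] at hyn
  have h20 : (2 : K) ≠ 0 := by intro h; simp [h] at h2
  set e := (y ^ 2 - x) / (2 * y) with he
  have hen : ‖e‖ = ‖y ^ 2 - x‖ := by simp [he, hyn, h2]
  have hmem : y - e ∈ Metric.closedBall (1 : K) r := by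
    rw [mem_closedBall_iff_norm]
    have : y - e - 1 = (y - 1) + (-e) := by ring
    rw [this]
    refine (IsUltrametricDist.norm_add_le_max _ _).trans ?_
    rw [norm_neg, hen]; exact max_le hy1 hmr
  have h3 := hmin hmem
  simp only [Set.mem_ofPred_eq] at h3
  have h4 : (y - e) ^ 2 - x = e ^ 2 := by
    have : e * (2 * y) = y ^ 2 - x := by rw [he]; field_simp
    linear_combination -this
  rw [h4, norm_pow, hen] at h3
  have hpos : 0 < ‖y ^ 2 - x‖ := norm_pos_iff.mpr h0
  nlinarith

lemma loc_res {K : Type*} [NontriviallyNormedField K] [IsUltrametricDist K] [ProperSpace K]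
    (h2 : ‖(2 : K)‖ = 1) : ∃ u p : K, ‖u‖ = 1 ∧ ¬ IsSquare u ∧
      (∀ a : K, ‖a‖ = 1 → IsSquare a ∨ IsSquare (u * a)) ∧ (∃ x y, u = x ^ 2 + y ^ 2) ∧
      0 < ‖p‖ ∧ ‖p‖ < 1 ∧ ∀ a : K, a ≠ 0 → ∃ n : ℤ, ‖a‖ = ‖p‖ ^ n := by
  have hcp : CompactSpace 𝒪[K] := by
    rw [← isCompact_univ_iff, Subtype.isCompact_iff]
    convert isCompact_closedBall (0 : K) 1
    ext x
    simp [Valuation.mem_integer_iff, ← NNReal.coe_le_coe]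
  let hr1 : (Valued.v : Valuation K NNReal).RankOne :=
    inferInstanceAs (NormedField.valuation (K := K)).RankOne
  have : IsDiscreteValuationRing 𝒪[K] := Valued.integer.isDiscreteValuationRing_of_compactSpace
  have : Finite 𝓀[K] := 
    (Valued.integer.compactSpace_iff_completeSpace_and_isDiscreteValuationRing_and_finite_residueField.mp hcp).2.2
  let res := IsLocalRing.residue 𝒪[K]
  have hker : ∀ a : 𝒪[K], res a = 0 ↔ ‖(a : K)‖ < 1 := by
    intro a
    rw [IsLocalRing.residue_eq_zero_iff, IsLocalRing.mem_maximalIdeal, mem_nonunits_iff,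
      Valued.integer.isUnit_iff_norm_eq_one]
    have := Valued.integer.norm_le_one a
    exact ⟨fun h => lt_of_le_of_ne this h, fun h => ne_of_lt h⟩
  -- lifting squares
  have hlift : ∀ a t : 𝒪[K], ‖(a : K)‖ = 1 → res a = res t ^ 2 → IsSquare (a : K) := by
    intro a t ha h
    have h1 : ‖((a - t ^ 2 : 𝒪[K]) : K)‖ < 1 := by
      rw [← hker]; simp [h]
    push_cast at h1
    have ht : ‖(t : K)‖ = 1 := by
      by_contra hne
      have hlt : ‖(t : K)‖ < 1 := lt_of_le_of_ne (Valued.integer.norm_le_one t) hne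
      rw [← hker] at hlt
      have : res a = 0 := by rw [h, hlt]; simp
      rw [hker] at this
      linarith
    have ht0 : (t : K) ≠ 0 := by intro h; simp [h] at ht
    obtain ⟨s, hs⟩ := loc_sq h2 ((a : K) / t ^ 2) (by
      have : (a : K) / t ^ 2 - 1 = (a - t ^ 2) / t ^ 2 := by field_simp
      rw [this, norm_div, norm_pow, ht]; simpa using h1)
    refine ⟨s * t, ?_⟩
    rw [div_eq_iff (by positivity)] at hs
    rw [hs]; ring
  have hO2 : res 2 ≠ 0 := by
    rw [Ne, hker]; change ¬ ‖(2 : K)‖ < 1; rw [h2]; simp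
  have hchar : ringChar 𝓀[K] ≠ 2 := by
    intro h
    apply hO2
    have := ringChar.Nat.cast_ringChar (R := 𝓀[K])
    rw [h] at this
    change (2 : 𝓀[K]) = 0 at this
    rw [map_ofNat]; exact this
  let := Fintype.ofFinite 𝓀[K]
  obtain ⟨ub, hub⟩ := FiniteField.exists_nonsquare hchar
  obtain ⟨u, rfl⟩ := IsLocalRing.residue_surjective ub
  have hmem : ∀ a : K, ‖a‖ ≤ 1 → a ∈ 𝒪[K] := fun a ha => Valued.integer.mem_iff.mpr ha
  have hun : ‖(u : K)‖ = 1 := by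
    by_contra hne
    have hlt : ‖(u : K)‖ < 1 := lt_of_le_of_ne (Valued.integer.norm_le_one u) hne
    rw [← hker] at hlt
    exact hub (by change IsSquare (res u); rw [hlt]; simp)
  obtain ⟨p, hp⟩ := IsDiscreteValuationRing.exists_irreducible 𝒪[K]
  have hp0 := Valued.integer.norm_irreducible_pos hp
  have hp1 := Valued.integer.norm_irreducible_lt_one hp
  refine ⟨u, p, hun, ?_, ?_, ?_, hp0, hp1, ?_⟩
  · rintro ⟨s, hs⟩
    have hsn : ‖s‖ = 1 := by
      have : ‖s‖ * ‖s‖ = 1 := by rw [← norm_mul, ← hs, hun]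
      nlinarith [norm_nonneg s]
    apply hub
    refine ⟨res ⟨s, hmem s hsn.le⟩, ?_⟩
    rw [← map_mul]
    congr 1
    exact Subtype.ext hs
  · intro a ha
    let a' : 𝒪[K] := ⟨a, hmem a ha.le⟩
    by_cases hsq : IsSquare (res a')
    · left
      obtain ⟨t, ht⟩ := hsq
      obtain ⟨t, rfl⟩ := IsLocalRing.residue_surjective t
      exact hlift a' t ha (by rw [ht, sq])
    · right
      have hu0 : res u ≠ 0 := by rw [Ne, hker]; rw [hun]; simp
      have ha0 : res a' ≠ 0 := by rw [Ne, hker]; change ¬ ‖a‖ < 1; rw [ha]; simp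
      have : IsSquare (res (u * a')) := by
        rw [map_mul]
        classical
        rw [← quadraticChar_one_iff_isSquare (mul_ne_zero hu0 ha0), map_mul]
        rw [← quadraticChar_neg_one_iff_not_isSquare] at hsq
        have h3 : quadraticChar 𝓀[K] (res u) = -1 := quadraticChar_neg_one_iff_not_isSquare.mpr hub
        rw [hsq, h3]; norm_num
      obtain ⟨t, ht⟩ := this
      obtain ⟨t, rfl⟩ := IsLocalRing.residue_surjective t
      have := hlift (u * a') t (by push_cast; rw [norm_mul, hun]; simpa using ha) (by rw [ht, sq])
      exact this
  · obtain ⟨x, y, hxy⟩ := FiniteField.exists_root_sum_quadratic (R := 𝓀[K])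
      (f := Polynomial.X ^ 2) (g := Polynomial.X ^ 2 - Polynomial.C (res u))
      (Polynomial.degree_X_pow 2) (Polynomial.degree_X_pow_sub_C (by decide) _)
      (FiniteField.odd_card_of_char_ne_two hchar)
    simp at hxy
    obtain ⟨x, rfl⟩ := IsLocalRing.residue_surjective x
    obtain ⟨y, rfl⟩ := IsLocalRing.residue_surjective y
    change res x ^ 2 + (res y ^ 2 - res u) = 0 at hxy
    have hx : res x ≠ 0 := by
      intro h
      rw [h] at hxy
      exact hub ⟨res y, by change res u = _; linear_combination -hxy⟩
    have hxx : res (u - y ^ 2) = res x ^ 2 := by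
      rw [map_sub, map_pow]; linear_combination -hxy
    have hnorm : ‖((u - y ^ 2 : 𝒪[K]) : K)‖ = 1 := by
      by_contra hne
      have hlt : ‖((u - y ^ 2 : 𝒪[K]) : K)‖ < 1 :=
        lt_of_le_of_ne (Valued.integer.norm_le_one (u - y ^ 2)) hne
      have := (hker _).mpr hlt
      rw [hxx] at this
      exact hx (by simpa using this)
    obtain ⟨s, hs⟩ := hlift _ x hnorm hxx
    push_cast at hs
    exact ⟨s, y, by linear_combination hs⟩
  · have key : ∀ a : K, a ≠ 0 → ‖a‖ ≤ 1 → ∃ n : ℤ, ‖a‖ = ‖(p : K)‖ ^ n := by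
      intro a ha0 ha
      obtain ⟨n, v, hv⟩ := IsDiscreteValuationRing.eq_unit_mul_pow_irreducible
        (x := (⟨a, hmem a ha⟩ : 𝒪[K])) (by intro h; exact ha0 (congrArg Subtype.val h)) hp
      have := congrArg (fun z : 𝒪[K] => ‖(z : K)‖) hv
      simp only [MulMemClass.coe_mul, SubmonoidClass.coe_pow, norm_mul, norm_pow] at this
      rw [Valued.integer.norm_coe_unit] at this
      exact ⟨n, by simpa using this⟩
    intro a ha
    rcases le_total ‖a‖ 1 with h | h
    · exact key a ha h
    · obtain ⟨n, hn⟩ := key a⁻¹ (inv_ne_zero ha) (by rw [norm_inv]; exact inv_le_one_of_one_le₀ h)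
      exact ⟨-n, by rw [zpow_neg, ← hn, norm_inv, inv_inv]⟩


end LocalPart

structure LocData (K : Type*) [Field K] (u p : K) : Prop where
  hu0 : u ≠ 0
  hp0 : p ≠ 0
  h2 : (2 : K) ≠ 0
  cls : ∀ a : K, a ≠ 0 → ∃ s : K, s ≠ 0 ∧
    (a = s ^ 2 ∨ a = u * s ^ 2 ∨ a = p * s ^ 2 ∨ a = u * p * s ^ 2)
  neg1 : ∃ s : K, s ≠ 0 ∧ (-1 = s ^ 2 ∨ -1 = u * s ^ 2)
  sum : ∃ x y : K, u = x ^ 2 + y ^ 2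
  nu : ¬ IsSquare u
  np : ¬ IsSquare p
  nup : ¬ IsSquare (u * p)
  L1 : ∀ x y : K, (x ≠ 0 ∨ y ≠ 0) → ∃ z : K, z ≠ 0 ∧
    (x ^ 2 - u * y ^ 2 = z ^ 2 ∨ x ^ 2 - u * y ^ 2 = u * z ^ 2)
  L2 : ∀ α β : K, (α = 1 ∨ α = u) → (β = 1 ∨ β = u) → ∀ x y : K, (x ≠ 0 ∨ y ≠ 0) →
    ∃ z : K, z ≠ 0 ∧ (α * x ^ 2 + p * β * y ^ 2 = α * z ^ 2 ∨
      α * x ^ 2 + p * β * y ^ 2 = p * β * z ^ 2)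

lemma locData_normed {K : Type*} [NontriviallyNormedField K] [IsUltrametricDist K] [ProperSpace K]
    (h2 : ‖(2 : K)‖ = 1) : ∃ u p : K, LocData K u p := by
  obtain ⟨u, p, hun, hus, hcl, hsum, hp0, hp1, hval⟩ := loc_res h2
  have hpp0 : p ≠ 0 := norm_pos_iff.mp hp0
  have hu0 : u ≠ 0 := by intro h; simp [h] at hun
  have hinj : ∀ m n : ℤ, ‖p‖ ^ m = ‖p‖ ^ n → m = n := fun m n h =>
    zpow_right_injective₀ hp0 (ne_of_lt hp1) h
  have nsq : ∀ a s : K, s ≠ 0 → ‖a‖ = ‖s‖ ^ 2 → ∃ z : K, z ≠ 0 ∧ (a = z ^ 2 ∨ a = u * z ^ 2) := by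
    intro a s hs ha
    have hsn : ‖s‖ ≠ 0 := norm_ne_zero_iff.mpr hs
    have h1 : ‖a / s ^ 2‖ = 1 := by rw [norm_div, norm_pow, ha]; field_simp
    have ha0 : a ≠ 0 := by
      intro h; rw [h] at h1; simp at h1
    rcases hcl _ h1 with ⟨t, ht⟩ | ⟨t, ht⟩
    · have e : a = (t * s) ^ 2 := by field_simp at ht; linear_combination ht
      refine ⟨t * s, ?_, Or.inl e⟩
      rintro h; rw [h] at e; exact ha0 (by simpa using e)
    · have e : a = u * (t * s / u) ^ 2 := by field_simp at ht ⊢; linear_combination ht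
      refine ⟨t * s / u, ?_, Or.inr e⟩
      rintro h; rw [h] at e; exact ha0 (by simpa using e)
  have dom : ∀ a b : K, ‖b‖ < ‖a‖ → ∃ s : K, s ≠ 0 ∧ a + b = a * s ^ 2 := by
    intro a b hab
    have han : 0 < ‖a‖ := lt_of_le_of_lt (norm_nonneg b) hab
    have ha0 : a ≠ 0 := norm_pos_iff.mp han
    obtain ⟨s, hs⟩ := loc_sq h2 (1 + b / a) (by
      rw [add_sub_cancel_left, norm_div, div_lt_one han]; exact hab)
    have e : a + b = a * s ^ 2 := by field_simp at hs; linear_combination hs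
    refine ⟨s, ?_, e⟩
    rintro rfl
    have : b = -a := by linear_combination e
    rw [this, norm_neg] at hab; exact lt_irrefl _ hab
  have hodd : ∀ x y : K, x ≠ 0 → y ≠ 0 → ‖x‖ ^ 2 ≠ ‖p‖ * ‖y‖ ^ 2 := by
    intro x y hx hy h
    obtain ⟨m, hm⟩ := hval x hx
    obtain ⟨n, hn⟩ := hval y hy
    rw [hm, hn] at h
    have : ‖p‖ ^ (m * 2) = ‖p‖ ^ (1 + n * 2) := by
      rw [zpow_add₀ hp0.ne', zpow_mul, zpow_mul, zpow_one]; exact_mod_cast h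
    have := hinj _ _ this
    omega
  have neg1 : ∃ s : K, s ≠ 0 ∧ (-1 = s ^ 2 ∨ -1 = u * s ^ 2) := nsq (-1) 1 one_ne_zero (by simp)
  refine ⟨u, p, hu0, hpp0, by intro h; simp [h] at h2, ?_, neg1, hsum, hus, ?_, ?_, ?_, ?_⟩
  · intro a ha
    obtain ⟨n, hn⟩ := hval a ha
    obtain ⟨m, rfl | rfl⟩ : ∃ m : ℤ, n = 2 * m ∨ n = 2 * m + 1 := ⟨n / 2, by omega⟩
    · obtain ⟨z, hz, h⟩ := nsq a (p ^ m) (zpow_ne_zero _ hpp0) (by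
        rw [hn, norm_zpow, mul_comm, zpow_mul]; norm_cast)
      exact ⟨z, hz, by tauto⟩
    · obtain ⟨z, hz, h⟩ := nsq (a / p) (p ^ m) (zpow_ne_zero _ hpp0) (by
        rw [norm_div, hn, norm_zpow, zpow_add₀ hp0.ne', mul_comm 2 m, zpow_mul, zpow_one]
        field_simp)
      refine ⟨z, hz, ?_⟩
      rcases h with h | h
      · right; right; left; field_simp at h; linear_combination h
      · right; right; right; field_simp at h; linear_combination h
  · rintro ⟨s, hs⟩
    have hs0 : s ≠ 0 := by rintro rfl; simp at hs; exact hpp0 hs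
    apply hodd s 1 hs0 one_ne_zero
    rw [hs]; simp [sq]
  · rintro ⟨s, hs⟩
    have hs0 : s ≠ 0 := by rintro rfl; simp at hs; tauto
    apply hodd s 1 hs0 one_ne_zero
    have := congrArg norm hs
    rw [norm_mul, norm_mul, hun] at this
    rw [norm_one]; linear_combination -this
  · intro x y hxy
    rcases lt_trichotomy ‖x‖ ‖y‖ with h | h | h
    · have hy : y ≠ 0 := by rw [← norm_pos_iff]; exact lt_of_le_of_lt (norm_nonneg x) h
      obtain ⟨s, hs, e⟩ := dom (-(u * y ^ 2)) (x ^ 2) (by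
        rw [norm_neg, norm_mul, hun, one_mul, norm_pow, norm_pow]; gcongr)
      obtain ⟨t, ht, e2⟩ := nsq (-(u * y ^ 2) * s ^ 2) (y * s) (mul_ne_zero hy hs) (by
        rw [norm_mul, norm_neg, norm_mul, hun, norm_pow, norm_pow, norm_mul]; ring)
      refine ⟨t, ht, ?_⟩
      have : x ^ 2 - u * y ^ 2 = -(u * y ^ 2) * s ^ 2 := by linear_combination e
      rwa [this]
    · have hx : x ≠ 0 := by
        rintro rfl
        simp at h; simp at hxy; exact hxy (norm_eq_zero.mp h.symm)
      have hy : y ≠ 0 := by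
        rintro rfl; simp at h; exact hx h
      apply nsq _ x hx
      have hle : ‖x ^ 2 - u * y ^ 2‖ ≤ ‖x‖ ^ 2 := by
        rw [sub_eq_add_neg]
        refine (IsUltrametricDist.norm_add_le_max _ _).trans ?_
        rw [norm_neg, norm_mul, hun, norm_pow, norm_pow, h]; simp
      by_contra hne
      have hlt := lt_of_le_of_ne hle hne
      obtain ⟨s, hs, e⟩ := dom (x ^ 2) (-(x ^ 2 - u * y ^ 2)) (by rw [norm_neg, norm_pow]; exact hlt)
      apply hus
      refine ⟨x * s / y, ?_⟩
      field_simp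
      linear_combination e
    · have hx : x ≠ 0 := by rw [← norm_pos_iff]; exact lt_of_le_of_lt (norm_nonneg y) h
      obtain ⟨s, hs, e⟩ := dom (x ^ 2) (-(u * y ^ 2)) (by
        rw [norm_neg, norm_mul, hun, one_mul, norm_pow, norm_pow]; gcongr)
      exact ⟨x * s, mul_ne_zero hx hs, Or.inl (by linear_combination e)⟩
  · intro α β hα hβ x y hxy
    have hαn : ‖α‖ = 1 := by rcases hα with rfl | rfl <;> simp [hun]
    have hβn : ‖β‖ = 1 := by rcases hβ with rfl | rfl <;> simp [hun]
    by_cases hx : x = 0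
    · subst hx
      exact ⟨y, by simpa using hxy, Or.inr (by ring)⟩
    by_cases hy : y = 0
    · subst hy
      exact ⟨x, by simpa using hxy, Or.inl (by ring)⟩
    have n1 : ‖α * x ^ 2‖ = ‖x‖ ^ 2 := by rw [norm_mul, hαn, norm_pow, one_mul]
    have n2 : ‖p * β * y ^ 2‖ = ‖p‖ * ‖y‖ ^ 2 := by rw [norm_mul, norm_mul, hβn, norm_pow, mul_one]
    rcases lt_or_gt_of_ne (hodd x y hx hy) with h | h
    · obtain ⟨s, hs, e⟩ := dom (p * β * y ^ 2) (α * x ^ 2) (by rw [n1, n2]; exact h)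
      exact ⟨y * s, mul_ne_zero hy hs, Or.inr (by linear_combination e)⟩
    · obtain ⟨s, hs, e⟩ := dom (α * x ^ 2) (p * β * y ^ 2) (by rw [n1, n2]; exact h)
      exact ⟨x * s, mul_ne_zero hx hs, Or.inl (by linear_combination e)⟩

lemma locData_exists (q : ℕ) [Fact q.Prime] (hq : q ≠ 2) (K : Type*) [Field K]
    [Algebra ℚ_[q] K] [FiniteDimensional ℚ_[q] K] : ∃ u p : K, LocData K u p := by
  let _ : NontriviallyNormedField K := spectralNorm.nontriviallyNormedField ℚ_[q] K
  have : IsUltrametricDist K := IsUltrametricDist.isUltrametricDist_of_isNonarchimedean_norm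
    (isNonarchimedean_spectralNorm (K := ℚ_[q]) (L := K))
  let _ : NormedSpace ℚ_[q] K := spectralNorm.normedSpace ℚ_[q] K
  have : ProperSpace K := FiniteDimensional.proper ℚ_[q] K
  apply locData_normed
  have h1 : ‖(2 : K)‖ = ‖(2 : ℚ_[q])‖ := by
    have := spectralNorm_extends (L := K) (2 : ℚ_[q])
    rw [← this, map_ofNat]; rfl
  rw [h1]
  have := (Padic.norm_natCast_eq_one_iff (p := q) (n := 2)).mpr
    ((Nat.coprime_primes Fact.out Nat.prime_two).mpr hq)
  simpa using this


section Isom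
variable {K : Type} [Field K]
variable {M M' N N' L : Type} [AddCommGroup M] [Module K M] [AddCommGroup M'] [Module K M']
  [AddCommGroup N] [Module K N] [AddCommGroup N'] [Module K N'] [AddCommGroup L] [Module K L]

lemma QIsom.refl (Q : QuadraticForm K M) : QIsom Q Q := ⟨LinearEquiv.refl K M, fun _ => rfl⟩

lemma QIsom.symm {Q : QuadraticForm K M} {Q' : QuadraticForm K M'} (h : QIsom Q Q') :
    QIsom Q' Q := by
  obtain ⟨φ, h⟩ := h
  exact ⟨φ.symm, fun x => by rw [← h, LinearEquiv.apply_symm_apply]⟩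

lemma QIsom.trans {Q : QuadraticForm K M} {Q' : QuadraticForm K M'} {Q'' : QuadraticForm K N}
    (h : QIsom Q Q') (h' : QIsom Q' Q'') : QIsom Q Q'' := by
  obtain ⟨φ, h⟩ := h
  obtain ⟨ψ, h'⟩ := h'
  exact ⟨φ.trans ψ, fun x => by rw [LinearEquiv.trans_apply, h', h]⟩

lemma QIsom.prod {Q : QuadraticForm K M} {Q' : QuadraticForm K M'} {P : QuadraticForm K N}
    {P' : QuadraticForm K N'} (h : QIsom Q Q') (h' : QIsom P P') :
    QIsom (Q.prod P) (Q'.prod P') := by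
  obtain ⟨φ, h⟩ := h
  obtain ⟨ψ, h'⟩ := h'
  exact ⟨φ.prodCongr ψ, fun x => by simp [h, h']⟩

lemma QIsom.prodComm (Q : QuadraticForm K M) (P : QuadraticForm K N) :
    QIsom (Q.prod P) (P.prod Q) :=
  ⟨LinearEquiv.prodComm K M N, fun x => by simp [add_comm]⟩

lemma QIsom.prodAssoc (Q : QuadraticForm K M) (P : QuadraticForm K N) (R : QuadraticForm K L) :
    QIsom ((Q.prod P).prod R) (Q.prod (P.prod R)) :=
  ⟨LinearEquiv.prodAssoc K M N L, fun x => by simp [add_assoc]⟩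

lemma QIsom.prodProdProdComm (Q : QuadraticForm K M) (Q' : QuadraticForm K M')
    (P : QuadraticForm K N) (P' : QuadraticForm K N') :
    QIsom ((Q.prod Q').prod (P.prod P')) ((Q.prod P).prod (Q'.prod P')) :=
  ⟨LinearEquiv.prodProdProdComm K M M' N N', fun x => by simp; ring⟩

lemma QIsom.prodUnit [Subsingleton N] (Q : QuadraticForm K M) (P : QuadraticForm K N) :
    QIsom (Q.prod P) Q :=
  ⟨{ toFun := fun x => x.1
     map_add' := fun _ _ => rfl
     map_smul' := fun _ _ => rfl
     invFun := fun x => (x, 0)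
     left_inv := fun x => Prod.ext rfl (Subsingleton.elim _ _)
     right_inv := fun _ => rfl }, fun x => by
      have : x.2 = 0 := Subsingleton.elim _ _
      simp [this]⟩

lemma QIsom.finrank {Q : QuadraticForm K M} {Q' : QuadraticForm K M'} (h : QIsom Q Q') :
    Module.finrank K M = Module.finrank K M' := by
  obtain ⟨φ, _⟩ := h
  exact φ.finrank_eq

lemma QIsom.piSucc {n : ℕ} (Q : Fin (n + 1) → QuadraticForm K M) :
    QIsom (QuadraticMap.pi Q) ((Q 0).prod (QuadraticMap.pi (fun i : Fin n => Q i.succ))) := by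
  apply QIsom.symm
  exact ⟨Fin.consLinearEquiv K (fun _ => M), fun x => by
    simp [QuadraticMap.pi_apply, Fin.sum_univ_succ]⟩

lemma hypSum_succ (n : ℕ) : QIsom (HypSum K (n + 1)) ((HypForm K).prod (HypSum K n)) :=
  QIsom.piSucc _

lemma hypSum_add (a b : ℕ) : QIsom ((HypSum K a).prod (HypSum K b)) (HypSum K (a + b)) := by
  induction a with
  | zero =>
    rw [Nat.zero_add]
    exact (QIsom.prodComm _ _).trans (QIsom.prodUnit _ _)
  | succ a ih =>
    rw [Nat.succ_add]
    exact ((hypSum_succ a).prod (QIsom.refl _)).trans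
      ((QIsom.prodAssoc _ _ _).trans (((QIsom.refl _).prod ih).trans (hypSum_succ _).symm))

/-- one-dimensional form -/
noncomputable def oneF (a : K) : QuadraticForm K K := a • QuadraticMap.sq

@[simp] lemma oneF_apply (a x : K) : oneF a x = a * (x * x) := by simp [oneF]

lemma hyp_diag (h2 : (2 : K) ≠ 0) {a : K} (ha : a ≠ 0) :
    QIsom (HypForm K) ((oneF a).prod (oneF (-a))) := by
  apply QIsom.symm
  refine ⟨LinearEquiv.ofLinearMap
    (LinearMap.prod (a • (LinearMap.fst K K K + LinearMap.snd K K K))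
      (LinearMap.fst K K K - LinearMap.snd K K K))
    (LinearMap.prod ((2 : K)⁻¹ • (a⁻¹ • LinearMap.fst K K K + LinearMap.snd K K K))
      ((2 : K)⁻¹ • (a⁻¹ • LinearMap.fst K K K - LinearMap.snd K K K))) ?_ ?_, ?_⟩
  · ext <;> simp <;> field_simp <;> ring
  · ext <;> simp <;> field_simp <;> ring_nf <;> simp
  · rintro ⟨x, y⟩
    simp [HypForm]; ring

/-- reflection-type transitivity -/
lemma exists_isometry_of_eq (h2 : (2 : K) ≠ 0) (Q : QuadraticForm K M) (v w : M)
    (hvw : Q v = Q w) (hv : Q v ≠ 0) : ∃ σ : M ≃ₗ[K] M, (∀ x, Q (σ x) = Q x) ∧ σ v = w := by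
  -- reflection
  have refl : ∀ r : M, Q r ≠ 0 → ∃ σ : M ≃ₗ[K] M, (∀ x, Q (σ x) = Q x) ∧
      ∀ x, σ x = x - (QuadraticMap.polar Q x r / Q r) • r := by
    intro r hr
    have hrr : QuadraticMap.polar Q r r = 2 * Q r := by
      rw [QuadraticMap.polar_self]; simp
    let f : M →ₗ[K] M := LinearMap.id - ((Q r)⁻¹ • (Q.polarBilin.flip r)).smulRight r
    have hf : ∀ x, f x = x - (QuadraticMap.polar Q x r / Q r) • r := by
      intro x; simp [f, div_eq_inv_mul]
    have hff : f ∘ₗ f = LinearMap.id := by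
      ext x
      rw [LinearMap.comp_apply, LinearMap.id_apply, hf (f x), hf x]
      rw [QuadraticMap.polar_sub_left, QuadraticMap.polar_smul_left, hrr]
      rw [sub_sub, ← add_smul]
      convert sub_zero x
      rw [smul_eq_mul]
      convert zero_smul K r
      field_simp; ring
    refine ⟨LinearEquiv.ofLinearMap f f hff hff, ?_, hf⟩
    intro x
    change Q (f x) = Q x
    rw [hf, sub_eq_add_neg, ← neg_smul, QuadraticMap.map_add Q, QuadraticMap.map_smul,
      QuadraticMap.polar_smul_right]
    simp only [smul_eq_mul]
    field_simp; ring
  have hsub : Q (v - w) = Q v + Q w - QuadraticMap.polar Q v w := by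
    rw [sub_eq_add_neg, QuadraticMap.map_add Q, QuadraticMap.map_neg, QuadraticMap.polar_neg_right]
    ring
  have hadd : Q (v + w) = Q v + Q w + QuadraticMap.polar Q v w := QuadraticMap.map_add Q v w
  have hvv : QuadraticMap.polar Q v v = 2 * Q v := by
    rw [QuadraticMap.polar_self]; simp
  by_cases h : Q (v - w) = 0
  · have h3 : Q (v + w) ≠ 0 := by
      intro h'
      apply hv
      have : 2 * (2 * Q v) = 0 := by linear_combination h - hsub + h' - hadd + 2 * hvw
      simpa [h2] using this
    obtain ⟨σ, h4, h5⟩ := refl (v + w) h3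
    refine ⟨σ.trans (LinearEquiv.neg K), ?_, ?_⟩
    · intro x; simp [h4]
    · rw [LinearEquiv.trans_apply, h5, LinearEquiv.neg_apply, QuadraticMap.polar_add_right, hvv]
      have : (2 * Q v + QuadraticMap.polar Q v w) / Q (v + w) = 1 := by
        rw [div_eq_one_iff_eq h3, hadd, ← hvw]; ring
      rw [this, one_smul]; abel
  · obtain ⟨σ, h4, h5⟩ := refl (v - w) h
    refine ⟨σ, h4, ?_⟩
    rw [h5, QuadraticMap.polar_sub_right, hvv]
    have : (2 * Q v - QuadraticMap.polar Q v w) / Q (v - w) = 1 := by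
      rw [div_eq_one_iff_eq h, hsub, ← hvw]; ring
    rw [this, one_smul]; abel

lemma cancel_one (h2 : (2 : K) ≠ 0) {a : K} (ha : a ≠ 0) {Q : QuadraticForm K M}
    {Q' : QuadraticForm K M'} (h : QIsom ((oneF a).prod Q) ((oneF a).prod Q')) : QIsom Q Q' := by
  obtain ⟨φ, h⟩ := h
  obtain ⟨σ, hσ, hv⟩ := exists_isometry_of_eq h2 ((oneF a).prod Q') (φ (1, 0)) (1, 0)
    (by rw [h]; simp) (by rw [h]; simpa using ha)
  let ψ := φ.trans σ
  have hψ : ∀ x, ((oneF a).prod Q') (ψ x) = ((oneF a).prod Q) x := fun x => by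
    simp only [ψ, LinearEquiv.trans_apply]; rw [hσ, h]
  have hψ1 : ψ (1, 0) = (1, 0) := hv
  have hfst : ∀ m : M, (ψ (0, m)).1 = 0 := by
    intro m
    have h1 := hψ (1, m)
    have h3 := hψ (0, m)
    have : ((1 : K), m) = (1, 0) + (0, m) := by simp
    rw [this, map_add, hψ1] at h1
    simp only [QuadraticMap.prod_apply, oneF_apply, Prod.fst_add, Prod.snd_add, zero_add,
      add_zero] at h1 h3
    have : 2 * a * (ψ (0, m)).1 = 0 := by linear_combination h1 - h3
    simpa [h2, ha] using this
  have hsymm1 : ψ.symm (1, 0) = (1, 0) := by rw [LinearEquiv.symm_apply_eq, hψ1]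
  have hfst' : ∀ m : M', (ψ.symm (0, m)).1 = 0 := by
    intro m
    have hψs : ∀ x, ((oneF a).prod Q) (ψ.symm x) = ((oneF a).prod Q') x := fun x => by
      rw [← hψ, LinearEquiv.apply_symm_apply]
    have h1 := hψs (1, m)
    have h3 := hψs (0, m)
    have : ((1 : K), m) = (1, 0) + (0, m) := by simp
    rw [this, map_add, hsymm1] at h1
    simp only [QuadraticMap.prod_apply, oneF_apply, Prod.fst_add, Prod.snd_add, zero_add,
      add_zero] at h1 h3
    have : 2 * a * (ψ.symm (0, m)).1 = 0 := by linear_combination h1 - h3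
    simpa [h2, ha] using this
  refine ⟨LinearEquiv.ofLinearMap
    (LinearMap.snd K K M' ∘ₗ ψ.toLinearMap ∘ₗ LinearMap.inr K K M)
    (LinearMap.snd K K M ∘ₗ ψ.symm.toLinearMap ∘ₗ LinearMap.inr K K M') ?_ ?_, ?_⟩
  · ext m
    simp only [LinearMap.comp_apply, LinearMap.inr_apply, LinearMap.snd_apply, LinearEquiv.coe_coe,
      LinearMap.id_apply]
    have : ((0 : K), (ψ.symm (0, m)).2) = ψ.symm (0, m) := Prod.ext (hfst' m).symm rfl
    rw [this, LinearEquiv.apply_symm_apply]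
  · ext m
    simp only [LinearMap.comp_apply, LinearMap.inr_apply, LinearMap.snd_apply, LinearEquiv.coe_coe,
      LinearMap.id_apply]
    have : ((0 : K), (ψ (0, m)).2) = ψ (0, m) := Prod.ext (hfst m).symm rfl
    rw [this, LinearEquiv.symm_apply_apply]
  · intro m
    have h3 := hψ (0, m)
    simp only [QuadraticMap.prod_apply, oneF_apply, hfst] at h3
    simpa using h3

lemma cancel_hyp (h2 : (2 : K) ≠ 0) {Q : QuadraticForm K M} {Q' : QuadraticForm K M'}
    (h : QIsom ((HypForm K).prod Q) ((HypForm K).prod Q')) : QIsom Q Q' := by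
  have key : ∀ {X : Type} [AddCommGroup X] [Module K X] (R : QuadraticForm K X),
      QIsom ((HypForm K).prod R) ((oneF 1).prod ((oneF (-1)).prod R)) := fun R =>
    ((hyp_diag h2 one_ne_zero).prod (QIsom.refl _)).trans (QIsom.prodAssoc _ _ _)
  exact cancel_one h2 (neg_ne_zero.mpr one_ne_zero) (cancel_one h2 one_ne_zero
    ((key Q).symm.trans (h.trans (key Q'))))

lemma cancel_hypSum (h2 : (2 : K) ≠ 0) (n : ℕ) {Q : QuadraticForm K M} {Q' : QuadraticForm K M'}
    (h : QIsom (Q.prod (HypSum K n)) (Q'.prod (HypSum K n))) : QIsom Q Q' := by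
  induction n with
  | zero => exact (QIsom.prodUnit _ _).symm.trans (h.trans (QIsom.prodUnit _ _))
  | succ n ih =>
    apply ih
    have key : ∀ {X : Type} [AddCommGroup X] [Module K X] (R : QuadraticForm K X),
      QIsom (R.prod (HypSum K (n + 1))) ((HypForm K).prod (R.prod (HypSum K n))) := fun R =>
      ((QIsom.refl _).prod (hypSum_succ n)).trans ((QIsom.prodAssoc _ _ _).symm.trans
        (((QIsom.prodComm _ _).prod (QIsom.refl _)).trans (QIsom.prodAssoc _ _ _)))
    exact cancel_hyp h2 ((key Q).symm.trans (h.trans (key Q')))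

/-- Witt equivalent forms: the one of smaller dimension plus hyperbolic planes. -/
lemma WittEquiv.cancel (h2 : (2 : K) ≠ 0) {Q : QuadraticForm K M} {Q' : QuadraticForm K M'}
    (h : WittEquiv Q Q') : (∃ n, QIsom Q (Q'.prod (HypSum K n))) ∨
      (∃ n, QIsom Q' (Q.prod (HypSum K n))) := by
  obtain ⟨a, b, h⟩ := h
  rcases le_total a b with hab | hab
  · obtain ⟨n, rfl⟩ := Nat.exists_eq_add_of_le' hab
    left
    refine ⟨n, cancel_hypSum h2 a (h.trans ?_)⟩
    exact ((QIsom.refl _).prod (hypSum_add n a).symm).trans (QIsom.prodAssoc _ _ _).symm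
  · obtain ⟨n, rfl⟩ := Nat.exists_eq_add_of_le' hab
    right
    refine ⟨n, cancel_hypSum h2 b (h.symm.trans ?_)⟩
    exact ((QIsom.refl _).prod (hypSum_add n b).symm).trans (QIsom.prodAssoc _ _ _).symm

lemma QIsom.aniso {Q : QuadraticForm K M} {Q' : QuadraticForm K M'} (h : QIsom Q Q')
    (hQ : Q.Anisotropic) : Q'.Anisotropic := by
  obtain ⟨φ, h⟩ := h.symm
  intro x hx
  have := hQ (φ x) (by rw [h, hx])
  simpa using this

lemma aniso_hyp_zero {Q : QuadraticForm K M} {n : ℕ} (h : (Q.prod (HypSum K n)).Anisotropic) :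
    n = 0 := by
  by_contra hn
  obtain ⟨m, rfl⟩ := Nat.exists_eq_succ_of_ne_zero hn
  have := h (0, fun _ => (1, 0)) (by simp [HypSum, HypForm])
  have := congrFun (congrArg Prod.snd this) 0
  simp at this

lemma aniso_witt_isom (h2 : (2 : K) ≠ 0) {Q : QuadraticForm K M} {Q' : QuadraticForm K M'}
    (h : WittEquiv Q Q') (hQ : Q.Anisotropic) (hQ' : Q'.Anisotropic) : QIsom Q Q' := by
  rcases h.cancel h2 with ⟨n, hn⟩ | ⟨n, hn⟩
  · obtain rfl := aniso_hyp_zero (hn.aniso hQ)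
    exact hn.trans (QIsom.prodUnit _ _)
  · obtain rfl := aniso_hyp_zero (hn.aniso hQ')
    exact (hn.trans (QIsom.prodUnit _ _)).symm

lemma finrank_hypSum (n : ℕ) : Module.finrank K (Fin n → K × K) = 2 * n := by
  rw [Module.finrank_pi_fintype]; simp; ring

lemma dim_witt_isom (h2 : (2 : K) ≠ 0) [FiniteDimensional K M] [FiniteDimensional K M']
    {Q : QuadraticForm K M} {Q' : QuadraticForm K M'}
    (h : WittEquiv Q Q') (hd : Module.finrank K M = Module.finrank K M') : QIsom Q Q' := by
  rcases h.cancel h2 with ⟨n, hn⟩ | ⟨n, hn⟩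
  · have := hn.finrank
    rw [Module.finrank_prod, finrank_hypSum] at this
    obtain rfl : n = 0 := by omega
    exact hn.trans (QIsom.prodUnit _ _)
  · have := hn.finrank
    rw [Module.finrank_prod, finrank_hypSum] at this
    obtain rfl : n = 0 := by omega
    exact (hn.trans (QIsom.prodUnit _ _)).symm

lemma WittEquiv.of_isom {Q : QuadraticForm K M} {Q' : QuadraticForm K M'} (h : QIsom Q Q') :
    WittEquiv Q Q' := ⟨0, 0, h.prod (QIsom.refl _)⟩

lemma WittEquiv.symm {Q : QuadraticForm K M} {Q' : QuadraticForm K M'} (h : WittEquiv Q Q') :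
    WittEquiv Q' Q := by
  obtain ⟨a, b, h⟩ := h
  exact ⟨b, a, h.symm⟩

lemma WittEquiv.trans {Q : QuadraticForm K M} {Q' : QuadraticForm K M'} {Q'' : QuadraticForm K N}
    (h : WittEquiv Q Q') (h' : WittEquiv Q' Q'') : WittEquiv Q Q'' := by
  obtain ⟨a, b, h⟩ := h
  obtain ⟨c, d, h'⟩ := h'
  refine ⟨a + c, d + b, ?_⟩
  refine ((QIsom.refl _).prod (hypSum_add a c).symm).trans ?_
  refine (QIsom.prodAssoc _ _ _).symm.trans ?_
  refine (h.prod (QIsom.refl _)).trans ?_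
  refine (QIsom.prodAssoc _ _ _).trans ?_
  refine ((QIsom.refl _).prod (QIsom.prodComm _ _)).trans ?_
  refine (QIsom.prodAssoc _ _ _).symm.trans ?_
  refine (h'.prod (QIsom.refl _)).trans ?_
  refine (QIsom.prodAssoc _ _ _).trans ?_
  exact (QIsom.refl _).prod (hypSum_add d b)

lemma WittEquiv.prod {Q : QuadraticForm K M} {Q' : QuadraticForm K M'} {P : QuadraticForm K N}
    {P' : QuadraticForm K N'} (h : WittEquiv Q Q') (h' : WittEquiv P P') :
    WittEquiv (Q.prod P) (Q'.prod P') := by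
  obtain ⟨a, b, h⟩ := h
  obtain ⟨c, d, h'⟩ := h'
  refine ⟨a + c, b + d, ?_⟩
  refine ((QIsom.refl _).prod (hypSum_add a c).symm).trans ?_
  refine (QIsom.prodProdProdComm _ _ _ _).trans ?_
  refine (h.prod h').trans ?_
  refine (QIsom.prodProdProdComm _ _ _ _).trans ?_
  exact (QIsom.refl _).prod (hypSum_add b d)

end Isom


section Witt

structure NF (K : Type) [Field K] : Type 1 where
  M : Type
  [g : AddCommGroup M]
  [m : Module K M]
  [fd : FiniteDimensional K M]
  Q : QuadraticForm K M
  nd : QNondeg Q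

attribute [instance] NF.g NF.m NF.fd

instance nfSetoid (K : Type) [Field K] : Setoid (NF K) where
  r A B := WittEquiv A.Q B.Q
  iseqv := ⟨fun _ => WittEquiv.of_isom (QIsom.refl _), fun h => h.symm, fun h h' => h.trans h'⟩

def WG (K : Type) [Field K] : Type 1 := Quotient (nfSetoid K)

variable {K : Type} [Field K]
variable {M N : Type} [AddCommGroup M] [Module K M] [FiniteDimensional K M]
  [AddCommGroup N] [Module K N] [FiniteDimensional K N]

lemma QNondeg.prod {Q : QuadraticForm K M} {P : QuadraticForm K N} (h : QNondeg Q)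
    (h' : QNondeg P) : QNondeg (Q.prod P) := by
  intro v hv
  refine Prod.ext (h _ fun w => ?_) (h' _ fun w => ?_)
  · have := hv (w, 0)
    rw [QuadraticMap.polar_prod] at this
    simpa using this
  · have := hv (0, w)
    rw [QuadraticMap.polar_prod] at this
    simpa using this

lemma QNondeg.neg {Q : QuadraticForm K M} (h : QNondeg Q) : QNondeg (-Q) := by
  intro v hv
  apply h
  intro w
  have := hv w
  simpa [QuadraticMap.polar_neg] using this

lemma QNondeg.pi {n : ℕ} {Q : Fin n → QuadraticForm K M} (h : ∀ i, QNondeg (Q i)) :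
    QNondeg (QuadraticMap.pi Q) := by
  classical
  intro v hv
  funext i
  apply h i
  intro w
  have := hv (Pi.single i w)
  rw [QuadraticMap.Ring.polar_pi] at this
  rw [Finset.sum_eq_single i] at this
  · simpa using this
  · intro j _ hj
    simp [Pi.single_eq_of_ne hj]
  · simp

lemma QNondeg.of_isom {Q : QuadraticForm K M} {P : QuadraticForm K N} (h : QNondeg Q)
    (hi : QIsom Q P) : QNondeg P := by
  obtain ⟨φ, hφ⟩ := hi.symm
  intro v hv
  have : φ v = 0 := by
    apply h
    intro w
    have := hv (φ.symm w)
    simp only [QuadraticMap.polar] at this ⊢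
    rw [← hφ, ← hφ, ← hφ] at this
    simpa using this
  simpa using this

lemma QNondeg.of_aniso (h2 : (2 : K) ≠ 0) {Q : QuadraticForm K M} (h : Q.Anisotropic) :
    QNondeg Q := by
  intro v hv
  apply h
  have := hv v
  rw [QuadraticMap.polar_self] at this
  simpa [h2] using this

lemma oneF_nondeg (h2 : (2 : K) ≠ 0) {a : K} (ha : a ≠ 0) : QNondeg (oneF a) := by
  apply QNondeg.of_aniso h2
  intro x hx
  simpa [ha] using hx

lemma hypForm_nondeg : QNondeg (HypForm K) := by
  intro v hv
  have h1 := hv (1, 0)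
  have h2 := hv (0, 1)
  simp [QuadraticMap.polar, HypForm] at h1 h2
  refine Prod.ext ?_ ?_
  · simp; linear_combination h2
  · simp; linear_combination h1

def cls (Q : QuadraticForm K M) (h : QNondeg Q) : WG K := Quotient.mk (nfSetoid K) ⟨M, Q, h⟩

lemma cls_eq_iff {Q : QuadraticForm K M} {h : QNondeg Q} {P : QuadraticForm K N} {h' : QNondeg P} :
    cls Q h = cls P h' ↔ WittEquiv Q P :=
  ⟨fun e => Quotient.exact e, fun e => Quotient.sound e⟩

lemma cls_eq_of_isom {Q : QuadraticForm K M} (h : QNondeg Q) {P : QuadraticForm K N} 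
    (h' : QNondeg P) (hi : QIsom Q P) : cls Q h = cls P h' := cls_eq_iff.mpr (.of_isom hi)

lemma neg_add_witt (h2 : (2 : K) ≠ 0) (Q : QuadraticForm K M) (h : QNondeg Q) :
    QIsom ((-Q).prod Q) (HypSum K (Module.finrank K M)) := by
  classical
  let b := Module.finBasis K M
  -- (x, y) ↦ (repr (y - x) i, polar (b i) (x+y) / 2)
  let f : M × M →ₗ[K] (Fin (Module.finrank K M) → K × K) :=
    LinearMap.pi fun i => LinearMap.prod
      ((b.coord i) ∘ₗ (LinearMap.snd K M M - LinearMap.fst K M M))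
      ((2 : K)⁻¹ • (Q.polarBilin (b i)) ∘ₗ (LinearMap.snd K M M + LinearMap.fst K M M))
  have hf : ∀ x i, f x i = (b.repr (x.2 - x.1) i, (2 : K)⁻¹ * QuadraticMap.polar Q (b i) (x.2 + x.1)) := by
    intro x i; simp [f]
  have hinj : Function.Injective f := by
    rw [← LinearMap.ker_eq_bot, LinearMap.ker_eq_bot']
    intro x hx
    have h1 : x.2 - x.1 = 0 := by
      apply b.repr.injective
      ext i
      have := congrArg Prod.fst (congrFun hx i)
      rw [hf] at this
      simpa using this
    have h3 : x.2 + x.1 = 0 := by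
      apply h
      intro w
      have hb : (Q.polarBilin.flip (x.2 + x.1)) = 0 := by
        apply b.ext
        intro i
        have := congrArg Prod.snd (congrFun hx i)
        rw [hf] at this
        simpa [h2] using this
      have := LinearMap.congr_fun hb w
      rw [QuadraticMap.polar_comm]
      simpa using this
    have h4 : (2 : K) • x.1 = 0 := by
      rw [two_smul]
      have : x.1 + x.1 = (x.2 + x.1) - (x.2 - x.1) := by abel
      rw [this, h1, h3]; simp
    have h5 : x.1 = 0 := by simpa [h2] using h4
    refine Prod.ext h5 ?_
    simpa [h5] using h3
  have hfr : Module.finrank K (M × M) = Module.finrank K (Fin (Module.finrank K M) → K × K) := by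
    rw [finrank_hypSum, Module.finrank_prod]; ring
  refine ⟨LinearEquiv.ofInjectiveOfFinrankEq f hinj hfr, ?_⟩
  intro x
  have hcoe : (LinearEquiv.ofInjectiveOfFinrankEq f hinj hfr) x = f x := rfl
  rw [hcoe]
  have : HypSum K (Module.finrank K M) (f x) =
      ∑ i, b.repr (x.2 - x.1) i * ((2 : K)⁻¹ * QuadraticMap.polar Q (b i) (x.2 + x.1)) := by
    simp [HypSum, HypForm, QuadraticMap.pi_apply, hf]
  rw [this]
  have h6 : QuadraticMap.polar Q (x.2 - x.1) (x.2 + x.1) =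
      ∑ i, b.repr (x.2 - x.1) i * QuadraticMap.polar Q (b i) (x.2 + x.1) := by
    have h7 : Q.polarBilin.flip (x.2 + x.1) (x.2 - x.1) =
      Q.polarBilin.flip (x.2 + x.1) (∑ i, b.repr (x.2 - x.1) i • b i) := by rw [b.sum_repr]
    rw [map_sum] at h7
    simpa using h7
  have h8 : ∑ i, b.repr (x.2 - x.1) i * ((2 : K)⁻¹ * QuadraticMap.polar Q (b i) (x.2 + x.1)) =
      (2 : K)⁻¹ * QuadraticMap.polar Q (x.2 - x.1) (x.2 + x.1) := by
    rw [h6, Finset.mul_sum]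
    exact Finset.sum_congr rfl fun i _ => by ring
  rw [h8, QuadraticMap.polar_sub_left, QuadraticMap.polar_add_right, QuadraticMap.polar_add_right,
    QuadraticMap.polar_self, QuadraticMap.polar_self, QuadraticMap.polar_comm Q x.1 x.2]
  simp
  field_simp
  ring

instance : Zero (WG K) := ⟨cls (0 : QuadraticForm K (Fin 0 → K)) (fun _ _ => Subsingleton.elim _ _)⟩

instance : Add (WG K) := ⟨Quotient.map₂ (fun A B => ⟨A.M × B.M, A.Q.prod B.Q, A.nd.prod B.nd⟩)
  (fun _ _ h _ _ h' => WittEquiv.prod h h')⟩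

lemma WittEquiv.neg {M' : Type} [AddCommGroup M'] [Module K M'] {Q : QuadraticForm K M}
    {Q' : QuadraticForm K M'} (h : WittEquiv Q Q') :
    WittEquiv (-Q) (-Q') := by
  have hyp : ∀ n, QIsom (-(HypSum K n)) (HypSum K n) := by
    intro n
    refine ⟨LinearEquiv.piCongrRight fun _ => (LinearEquiv.refl K K).prodCongr (LinearEquiv.neg K), ?_⟩
    intro x
    simp [HypSum, HypForm, QuadraticMap.pi_apply]
  obtain ⟨a, b, φ, h⟩ := h
  have : QIsom ((-Q).prod (-(HypSum K a))) ((-Q').prod (-(HypSum K b))) :=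
    ⟨φ, fun x => by
      have := congrArg Neg.neg (h x)
      simp only [QuadraticMap.prod_apply, QuadraticMap.neg_apply] at this ⊢
      linear_combination this⟩
  exact ⟨a, b, ((QIsom.refl _).prod (hyp a).symm).trans (this.trans ((QIsom.refl _).prod (hyp b)))⟩

instance : Neg (WG K) := ⟨Quotient.map (fun A => ⟨A.M, -A.Q, A.nd.neg⟩)
  (fun _ _ h => WittEquiv.neg h)⟩

lemma cls_prod {Q : QuadraticForm K M} (h : QNondeg Q) {P : QuadraticForm K N} (h' : QNondeg P) :
    cls (Q.prod P) (h.prod h') = cls Q h + cls P h' := rfl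

lemma cls_neg {Q : QuadraticForm K M} (h : QNondeg Q) : cls (-Q) h.neg = - cls Q h := rfl

lemma cls_unit [Subsingleton M] (Q : QuadraticForm K M) (h : QNondeg Q) : cls Q h = 0 := by
  apply cls_eq_of_isom
  exact (QIsom.prodUnit Q (0 : QuadraticForm K (Fin 0 → K))).symm.trans
    ((QIsom.prodComm _ _).trans (QIsom.prodUnit _ _))

/-- The additive group structure on the Witt group. -/
@[reducible] noncomputable def wgGroup (h2 : (2 : K) ≠ 0) : AddCommGroup (WG K) where
  add_assoc := by
    rintro ⟨a⟩ ⟨b⟩ ⟨c⟩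
    exact Quotient.sound (WittEquiv.of_isom (QIsom.prodAssoc _ _ _))
  zero_add := by
    rintro ⟨a⟩
    exact Quotient.sound (WittEquiv.of_isom ((QIsom.prodComm _ _).trans (QIsom.prodUnit _ _)))
  add_zero := by
    rintro ⟨a⟩
    exact Quotient.sound (WittEquiv.of_isom (QIsom.prodUnit _ _))
  add_comm := by
    rintro ⟨a⟩ ⟨b⟩
    exact Quotient.sound (WittEquiv.of_isom (QIsom.prodComm _ _))
  neg_add_cancel := by
    rintro ⟨a⟩
    refine Quotient.sound ⟨0, Module.finrank K a.M, ?_⟩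
    exact (QIsom.prodUnit _ _).trans ((neg_add_witt h2 a.Q a.nd).trans
      ((QIsom.prodUnit _ _).symm.trans (QIsom.prodComm _ _)))
  nsmul := nsmulRec
  zsmul := zsmulRec

/-- dimension parity -/
noncomputable def wdim : WG K → ZMod 2 :=
  Quotient.lift (fun A => (Module.finrank K A.M : ZMod 2)) (by
    rintro A B ⟨a, b, h⟩
    have := h.finrank
    rw [Module.finrank_prod, Module.finrank_prod, finrank_hypSum, finrank_hypSum] at this
    have := congrArg (Nat.cast : ℕ → ZMod 2) this
    have h2 : (2 : ZMod 2) = 0 := by decide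
    push_cast at this
    simpa [h2] using this)

lemma wdim_cls (Q : QuadraticForm K M) (h : QNondeg Q) : wdim (cls Q h) = Module.finrank K M := rfl

lemma wdim_add (x y : WG K) : wdim (x + y) = wdim x + wdim y := by
  revert x y
  rintro ⟨a⟩ ⟨b⟩
  change ((Module.finrank K (a.M × b.M) : ℕ) : ZMod 2) = _
  rw [Module.finrank_prod]; push_cast; rfl

lemma wdim_zero : wdim (0 : WG K) = 0 := by
  change ((Module.finrank K (Fin 0 → K) : ℕ) : ZMod 2) = 0
  simp

lemma cls_hyp : cls (HypForm K) hypForm_nondeg = 0 := by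
  apply cls_eq_iff.mpr
  refine ⟨0, 1, ?_⟩
  refine (QIsom.prodUnit _ _).trans ?_
  refine QIsom.trans ?_ (QIsom.prodComm _ _)
  refine QIsom.trans ?_ (QIsom.prodUnit _ _).symm
  exact (QIsom.prodUnit _ _).symm.trans (hypSum_succ 0).symm

lemma cls_pi (h2 : (2 : K) ≠ 0) {n : ℕ} (Q : Fin n → QuadraticForm K M) (h : ∀ i, QNondeg (Q i)) :
    letI := wgGroup h2
    cls (QuadraticMap.pi Q) (QNondeg.pi h) = ∑ i, cls (Q i) (h i) := by
  letI := wgGroup h2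
  induction n with
  | zero => simpa using cls_unit _ _
  | succ n ih =>
    rw [Fin.sum_univ_succ, ← ih (fun i => Q i.succ), ← cls_prod]
    exact cls_eq_of_isom _ _ (QIsom.piSucc Q)

lemma exists_diag (h2 : (2 : K) ≠ 0) (Q : QuadraticForm K M) (h : QNondeg Q) :
    ∃ w : Fin (Module.finrank K M) → K, (∀ i, w i ≠ 0) ∧
      QIsom Q (QuadraticMap.pi fun i => oneF (w i)) := by
  have : Invertible (2 : K) := invertibleOfNonzero h2
  obtain ⟨w, ⟨e⟩⟩ := QuadraticForm.equivalent_weightedSumSquares_units_of_nondegenerate' Q (by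
    intro v hv
    apply h
    intro w
    have := hv w
    rw [QuadraticMap.associated_apply] at this
    simpa [QuadraticMap.polar, h2] using this)
  refine ⟨fun i => w i, fun i => (w i).ne_zero, e.toLinearEquiv, fun x => ?_⟩
  have := e.map_app x
  rw [QuadraticMap.weightedSumSquares_apply] at this
  rw [← this, QuadraticMap.pi_apply]
  refine Finset.sum_congr rfl fun i _ => ?_
  rw [oneF_apply]
  rfl

end Witt


section Comb

/-- Tuple count in an abstract group where the index set hits every even element but one. -/
lemma tuple_count {G : Type*} [AddCommGroup G] {S : Type*} [Finite S] (hS : Nat.card S = 7)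
    (ι : S → G) (H : AddSubgroup G) (ω : G) (hω : ω ∈ H)
    (hH : ∀ s, ι s ∈ H) (hne : ∀ s, ι s ≠ ω) (hinj : Function.Injective ι)
    (hsurj : ∀ g ∈ H, g ≠ ω → ∃ s, ι s = g) (b : ℕ) : ∀ q ∈ H,
    8 * (Nat.card {c : Fin b → S // ∑ i, ι (c i) = q} : ℤ) = 7 ^ b - (-1) ^ b +
      (open Classical in if q = b • ω then 8 * (-1) ^ b else 0) := by
  classical
  have := Fintype.ofFinite S
  induction b with
  | zero =>
    intro q hq
    by_cases h : q = 0
    · subst h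
      have : Nat.card {c : Fin 0 → S // ∑ i, ι (c i) = 0} = 1 := by
        rw [Nat.card_eq_one_iff_unique]
        refine ⟨inferInstance, ⟨⟨fun i => i.elim0, by simp⟩⟩⟩
      rw [this]; simp
    · have : Nat.card {c : Fin 0 → S // ∑ i, ι (c i) = q} = 0 := by
        rw [Nat.card_eq_zero]
        left
        constructor
        rintro ⟨c, hc⟩
        apply h
        rw [← hc]; simp
      rw [this]; simp [h]
  | succ b ih =>
    intro q hq
    have hsum : ∀ c : Fin b → S, ∑ i, ι (c i) ∈ H := fun c => H.sum_mem fun i _ => hH _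
    have e : {c : Fin (b + 1) → S // ∑ i, ι (c i) = q} ≃
        {c : Fin b → S // ¬ (∑ i, ι (c i) = q - ω)} := by
      refine Equiv.ofBijective (fun c => ⟨fun i => c.1 i.succ, ?_⟩) ⟨?_, ?_⟩
      · intro h
        have h3 := c.2
        rw [Fin.sum_univ_succ, h] at h3
        apply hne (c.1 0)
        have : ι (c.1 0) = q - (q - ω) := by rw [eq_sub_iff_add_eq]; exact h3
        simpa using this
      · rintro ⟨c, hc⟩ ⟨c', hc'⟩ h
        have h1 : (fun i : Fin b => c i.succ) = fun i => c' i.succ := congrArg Subtype.val h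
        apply Subtype.ext
        change c = c'
        have h0 : c 0 = c' 0 := by
          apply hinj
          rw [Fin.sum_univ_succ] at hc hc'
          have h4 : ∑ i : Fin b, ι (c i.succ) = ∑ i : Fin b, ι (c' i.succ) :=
            Finset.sum_congr rfl fun i _ => congrArg ι (congrFun h1 i)
          rw [h4, ← hc'] at hc
          exact add_right_cancel hc
        funext i
        refine Fin.cases h0 (fun j => congrFun h1 j) i
      · rintro ⟨c, hc⟩
        obtain ⟨s, hs⟩ := hsurj (q - ∑ i, ι (c i)) (H.sub_mem hq (hsum c)) (by
          intro h
          apply hc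
          rw [← h]; abel)
        refine ⟨⟨Fin.cons s c, ?_⟩, ?_⟩
        · rw [Fin.sum_univ_succ]; simp [hs]
        · apply Subtype.ext
          funext i
          simp
    have hc : Nat.card {c : Fin (b + 1) → S // ∑ i, ι (c i) = q} +
        Nat.card {c : Fin b → S // ∑ i, ι (c i) = q - ω} = 7 ^ b := by
      rw [Nat.card_congr e, Nat.card_eq_fintype_card, Nat.card_eq_fintype_card,
        Fintype.card_subtype_compl]
      have h7 : Fintype.card (Fin b → S) = 7 ^ b := by
        rw [← Nat.card_eq_fintype_card, Nat.card_fun, hS]; simp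
      rw [h7, Nat.sub_add_cancel]
      rw [← h7]
      exact Fintype.card_subtype_le _
    have := ih (q - ω) (H.sub_mem hq hω)
    have hiff : q - ω = b • ω ↔ q = (b + 1) • ω := by
      rw [sub_eq_iff_eq_add, succ_nsmul]
    simp only [hiff] at this
    have hc' : (Nat.card {c : Fin (b + 1) → S // ∑ i, ι (c i) = q} : ℤ) +
        Nat.card {c : Fin b → S // ∑ i, ι (c i) = q - ω} = 7 ^ b := by exact_mod_cast hc
    split_ifs at this ⊢ <;> rw [pow_succ, pow_succ] <;> linarith

/-- Closure of a four element set. -/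
lemma four_closed {G : Type*} [AddCommGroup G] {x y : G} (h : x + x = y + y)
    (h' : x + x = 0 ∨ x + y = 0) {w : G} (hw : w = 0 ∨ w = x ∨ w = y ∨ w = x - y) :
    (w + x = 0 ∨ w + x = x ∨ w + x = y ∨ w + x = x - y) ∧
    (w + y = 0 ∨ w + y = x ∨ w + y = y ∨ w + y = x - y) := by
  have hd : x - y = y - x := by rw [sub_eq_sub_iff_add_eq_add, h]
  rcases h' with h' | h'
  · have hy : y + y = 0 := by rw [← h, h']
    have hny : -y = y := neg_eq_of_add_eq_zero_left hy
    have hxy : x - y = x + y := by rw [sub_eq_add_neg, hny]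
    rcases hw with rfl | rfl | rfl | rfl
    · simp
    · rw [h', hxy]; simp
    · rw [hy, hxy, add_comm w x]; simp
    · constructor
      · rw [hd]; simp
      · simp
  · have hy : y = -x := (neg_eq_of_add_eq_zero_right h').symm
    subst hy
    rcases hw with rfl | rfl | rfl | rfl
    · simp
    · simp
    · rw [← h]; simp
    · constructor
      · rw [hd]; simp
      · simp

end Comb

section Local

variable {K : Type} [Field K]

/-- class of a one-dimensional form -/
noncomputable def gcl (h2 : (2 : K) ≠ 0) (a : K) : WG K :=
  open Classical in if h : a ≠ 0 then cls (oneF a) (oneF_nondeg h2 h) else 0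

lemma gcl_of (h2 : (2 : K) ≠ 0) {a : K} (h : a ≠ 0) :
    gcl h2 a = cls (oneF a) (oneF_nondeg h2 h) := by
  simp only [gcl]; rw [dif_pos h]

lemma wdim_gcl (h2 : (2 : K) ≠ 0) {a : K} (h : a ≠ 0) : wdim (gcl h2 a) = 1 := by
  rw [gcl_of h2 h, wdim_cls]; simp

lemma gcl_sq (h2 : (2 : K) ≠ 0) {a s : K} (h : a ≠ 0) (hs : s ≠ 0) :
    gcl h2 (a * s ^ 2) = gcl h2 a := by
  rw [gcl_of h2 h, gcl_of h2 (mul_ne_zero h (pow_ne_zero _ hs))]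
  refine cls_eq_of_isom _ _ ⟨LinearEquiv.smulOfNeZero K K s hs, fun x => ?_⟩
  simp; ring

lemma gcl_neg (h2 : (2 : K) ≠ 0) {a : K} (h : a ≠ 0) : gcl h2 a + gcl h2 (-a) = 0 := by
  rw [gcl_of h2 h, gcl_of h2 (neg_ne_zero.mpr h), ← cls_prod, ← cls_hyp]
  exact cls_eq_of_isom _ _ (hyp_diag h2 h).symm

lemma gcl_two (h2 : (2 : K) ≠ 0) {a u r t : K} (h : a ≠ 0) (hu : u ≠ 0) (hr : u = r ^ 2 + t ^ 2) :
    gcl h2 a + gcl h2 a = gcl h2 (a * u) + gcl h2 (a * u) := by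
  rw [gcl_of h2 h, gcl_of h2 (mul_ne_zero h hu), ← cls_prod, ← cls_prod]
  symm
  let f : K × K →ₗ[K] K × K := LinearMap.prod
    (r • LinearMap.fst K K K - t • LinearMap.snd K K K)
    (t • LinearMap.fst K K K + r • LinearMap.snd K K K)
  have hinj : Function.Injective f := by
    rw [← LinearMap.ker_eq_bot, LinearMap.ker_eq_bot']
    rintro ⟨x, y⟩ hx
    have h1 := congrArg Prod.fst hx
    have h3 := congrArg Prod.snd hx
    simp [f] at h1 h3
    have h4 : u * x = 0 := by rw [hr]; linear_combination r * h1 + t * h3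
    have h5 : u * y = 0 := by rw [hr]; linear_combination r * h3 - t * h1
    simp [hu] at h4 h5
    simp [h4, h5]
  refine cls_eq_of_isom _ _ ⟨LinearEquiv.ofInjectiveEndo f hinj, fun x => ?_⟩
  have : LinearEquiv.ofInjectiveEndo f hinj x = f x := rfl
  rw [this]
  simp [f]
  rw [hr]; ring

/-- diagonal binary form -/
noncomputable def bin (a b : K) : QF K 2 := QuadraticMap.pi (fun i => oneF (![a, b] i))

lemma bin_apply (a b : K) (x : Fin 2 → K) : bin a b x = a * (x 0 * x 0) + b * (x 1 * x 1) := by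
  simp [bin, QuadraticMap.pi_apply]

lemma bin_nondeg (h2 : (2 : K) ≠ 0) {a b : K} (ha : a ≠ 0) (hb : b ≠ 0) : QNondeg (bin a b) := by
  apply QNondeg.pi
  intro i
  apply oneF_nondeg h2
  fin_cases i <;> simp [ha, hb]

lemma cls_bin (h2 : (2 : K) ≠ 0) {a b : K} (ha : a ≠ 0) (hb : b ≠ 0) (h : QNondeg (bin a b)) :
    cls (bin a b) h = gcl h2 a + gcl h2 b := by
  let _ := wgGroup h2
  have hh : ∀ i, QNondeg (oneF (![a, b] i)) := by
    intro i
    apply oneF_nondeg h2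
    fin_cases i <;> simp [ha, hb]
  have := cls_pi h2 _ hh
  rw [Fin.sum_univ_two] at this
  rw [gcl_of h2 ha, gcl_of h2 hb]
  exact this

/-- A binary form is never Witt equivalent to an anisotropic form of dimension four. -/
lemma no_binary {M : Type} [AddCommGroup M] [Module K M] [FiniteDimensional K M]
    (h2 : (2 : K) ≠ 0) {Q : QuadraticForm K M} (hQ : Q.Anisotropic)
    (h4 : Module.finrank K M = 4) {q : QF K 2} (hq : QNondeg q) : ¬ WittEquiv Q q := by
  intro h
  let _ := wgGroup h2
  have hH : QNondeg (HypSum K 1) := QNondeg.pi fun _ => hypForm_nondeg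
  have h0 : cls (HypSum K 1) hH = 0 := by
    have := cls_pi h2 (fun _ : Fin 1 => HypForm K) (fun _ => hypForm_nondeg)
    rw [cls_hyp] at this
    refine Eq.trans ?_ (this.trans (by simp))
    rfl
  have h1 : cls Q (.of_aniso h2 hQ) = cls (q.prod (HypSum K 1)) (hq.prod hH) := by
    rw [cls_prod hq hH, h0, add_zero]
    exact cls_eq_iff.mpr h
  have h3 := dim_witt_isom h2 (cls_eq_iff.mp h1) (by rw [Module.finrank_prod, finrank_hypSum]; simp [h4])
  have := aniso_hyp_zero (h3.aniso hQ)
  simp at this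

end Local


section Main

variable {K : Type} [Field K] {u p : K}

/-- first entries of the seven binary forms -/
def repA (u p : K) : Fin 7 → K := ![1, 1, p, 1, 1, u, u]
/-- second entries of the seven binary forms -/
def repB (u p : K) : Fin 7 → K := ![-1, -u, -(p * u), p, p * u, p, p * u]
/-- square classes -/
def sqc (u p : K) : Fin 4 → K := ![1, u, p, p * u]
/-- which binary form represents which square class -/
def tab : Fin 7 → Fin 4 → Bool :=
  ![![true, true, true, true], ![true, true, false, false], ![false, false, true, true],
    ![true, false, true, false], ![true, false, false, true], ![false, true, true, false],
    ![false, true, false, true]]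

lemma tab_inj : ∀ i j, (∀ k, tab i k = tab j k) → i = j := by decide

lemma repA_ne (D : LocData K u p) (i : Fin 7) : repA u p i ≠ 0 := by
  fin_cases i <;> simp [repA, D.hu0, D.hp0]

lemma repB_ne (D : LocData K u p) (i : Fin 7) : repB u p i ≠ 0 := by
  fin_cases i <;> simp [repB, D.hu0, D.hp0]

lemma sqc_inj (D : LocData K u p) (j k : Fin 4) (z : K) (h : sqc u p j = sqc u p k * z ^ 2) :
    j = k := by
  have hu0 := D.hu0
  have hp0 := D.hp0
  have nu : ∀ w : K, u ≠ w ^ 2 := fun w h => D.nu ⟨w, by rw [h]; ring⟩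
  have np : ∀ w : K, p ≠ w ^ 2 := fun w h => D.np ⟨w, by rw [h]; ring⟩
  have nup : ∀ w : K, u * p ≠ w ^ 2 := fun w h => D.nup ⟨w, by rw [h]; ring⟩
  fin_cases j <;> fin_cases k <;> simp [sqc] at h ⊢
  · exact nu (u * z) (by linear_combination u * h)
  · exact np (p * z) (by linear_combination p * h)
  · exact nup (u * p * z) (by linear_combination u * p * h)
  · exact nu z h
  · exact nup (p * z) (by linear_combination p * h)
  · have : u * (1 - p * z ^ 2) = 0 := by linear_combination h
    have : 1 - p * z ^ 2 = 0 := by simpa [hu0] using this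
    exact np (p * z) (by linear_combination p * this)
  · exact np z h
  · exact nup (u * z) (by linear_combination u * h)
  · have : p * (1 - u * z ^ 2) = 0 := by linear_combination h
    have : 1 - u * z ^ 2 = 0 := by simpa [hp0] using this
    exact nu (u * z) (by linear_combination u * this)
  · exact nup z (by linear_combination h)
  · have : u * (p - z ^ 2) = 0 := by linear_combination h
    have : p - z ^ 2 = 0 := by simpa [hu0] using this
    exact np z (by linear_combination this)
  · exact nu z (by simpa [hp0] using h)

lemma sqc_ne (D : LocData K u p) (j : Fin 4) : sqc u p j ≠ 0 := by
  fin_cases j <;> simp [sqc, D.hu0, D.hp0]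

/-- binary form represents a value -/
def BRep (a b c : K) : Prop := ∃ x y : K, a * x ^ 2 + b * y ^ 2 = c

lemma brep_of_isom {a b a' b' c : K} (h : QIsom (bin a b) (bin a' b')) (hc : BRep a b c) :
    BRep a' b' c := by
  obtain ⟨φ, h⟩ := h
  obtain ⟨x, y, hxy⟩ := hc
  refine ⟨φ ![x, y] 0, φ ![x, y] 1, ?_⟩
  have := h ![x, y]
  rw [bin_apply, bin_apply] at this
  simp only [Matrix.cons_val_zero, Matrix.cons_val_one] at this
  linear_combination this + hxy

lemma brep_sub (D : LocData K u p) (i : Fin 7) (j : Fin 4)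
    (h : BRep (repA u p i) (repB u p i) (sqc u p j)) : tab i j = true := by
  by_cases hi : i = 0
  · have : ∀ k, tab 0 k = true := by decide
    rw [hi]; exact this j
  suffices ∃ k z, tab i k = true ∧ sqc u p j = sqc u p k * z ^ 2 by
    obtain ⟨k, z, hk, hz⟩ := this
    rw [sqc_inj D j k z hz]; exact hk
  have hc := sqc_ne D j
  obtain ⟨x, y, hxy⟩ := h
  have hne : x ≠ 0 ∨ y ≠ 0 := by
    by_contra hh
    push Not at hh
    rw [hh.1, hh.2] at hxy
    apply hc; rw [← hxy]; ring
  generalize sqc u p j = c at *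
  fin_cases i <;> simp [repA, repB] at hxy
  · simp at hi
  · obtain ⟨z, -, hz | hz⟩ := D.L1 x y hne
    · exact ⟨0, z, rfl, by simp [sqc]; linear_combination hz - hxy⟩
    · exact ⟨1, z, rfl, by simp [sqc]; linear_combination hz - hxy⟩
  · obtain ⟨z, -, hz | hz⟩ := D.L1 x y hne
    · exact ⟨2, z, rfl, by simp [sqc]; linear_combination p * hz - hxy⟩
    · exact ⟨3, z, rfl, by simp [sqc]; linear_combination p * hz - hxy⟩
  · obtain ⟨z, -, hz | hz⟩ := D.L2 1 1 (by simp) (by simp) x y hne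
    · exact ⟨0, z, rfl, by simp [sqc]; linear_combination hz - hxy⟩
    · exact ⟨2, z, rfl, by simp [sqc]; linear_combination hz - hxy⟩
  · obtain ⟨z, -, hz | hz⟩ := D.L2 1 u (by simp) (by simp) x y hne
    · exact ⟨0, z, rfl, by simp [sqc]; linear_combination hz - hxy⟩
    · exact ⟨3, z, rfl, by simp [sqc]; linear_combination hz - hxy⟩
  · obtain ⟨z, -, hz | hz⟩ := D.L2 u 1 (by simp) (by simp) x y hne
    · exact ⟨1, z, rfl, by simp [sqc]; linear_combination hz - hxy⟩
    · exact ⟨2, z, rfl, by simp [sqc]; linear_combination hz - hxy⟩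
  · obtain ⟨z, -, hz | hz⟩ := D.L2 u u (by simp) (by simp) x y hne
    · exact ⟨1, z, rfl, by simp [sqc]; linear_combination hz - hxy⟩
    · exact ⟨3, z, rfl, by simp [sqc]; linear_combination hz - hxy⟩

lemma brep_u (D : LocData K u p) : ∃ x y : K, x ^ 2 - u * y ^ 2 = u := by
  obtain ⟨s, -, hs | hs⟩ := D.neg1
  · exact ⟨0, s, by linear_combination u * hs⟩
  · obtain ⟨x, y, h⟩ := D.sum
    exact ⟨x, s * y, by linear_combination y ^ 2 * hs - h⟩

lemma brep_sup (D : LocData K u p) (i : Fin 7) (j : Fin 4) (h : tab i j = true) :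
    BRep (repA u p i) (repB u p i) (sqc u p j) := by
  obtain ⟨x, y, hxy⟩ := brep_u D
  have h2 := D.h2
  by_cases hi : i = 0
  · subst hi
    refine ⟨(sqc u p j + 1) / 2, (sqc u p j - 1) / 2, ?_⟩
    simp only [repA, repB, Matrix.cons_val_zero]
    field_simp
    ring
  fin_cases i <;> fin_cases j <;> simp [tab] at h hi <;> simp [repA, repB, sqc, BRep]
  · exact ⟨1, 0, by ring⟩
  · exact ⟨x, y, by linear_combination hxy⟩
  · exact ⟨1, 0, by ring⟩
  · exact ⟨x, y, by linear_combination p * hxy⟩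
  · exact ⟨1, 0, by ring⟩
  · exact ⟨0, 1, by ring⟩
  · exact ⟨1, 0, by ring⟩
  · exact ⟨0, 1, by ring⟩
  · exact ⟨1, 0, by ring⟩
  · exact ⟨0, 1, by ring⟩
  · exact ⟨1, 0, by ring⟩
  · exact ⟨0, 1, by ring⟩

lemma rep_inj (D : LocData K u p) (i j : Fin 7)
    (h : QIsom (bin (repA u p i) (repB u p i)) (bin (repA u p j) (repB u p j))) : i = j := by
  apply tab_inj
  intro k
  rw [Bool.eq_iff_iff]
  exact ⟨fun hk => brep_sub D j k (brep_of_isom h (brep_sup D i k hk)),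
    fun hk => brep_sub D i k (brep_of_isom h.symm (brep_sup D j k hk))⟩

/-- the anisotropic four-dimensional form -/
noncomputable def omF (u p : K) : QuadraticForm K ((Fin 2 → K) × (Fin 2 → K)) :=
  (bin 1 (-u)).prod (bin p (-(p * u)))

lemma omF_aniso (D : LocData K u p) : (omF u p).Anisotropic := by
  rintro ⟨v, w⟩ h
  simp only [omF, QuadraticMap.prod_apply, bin_apply] at h
  have key : ∀ v : Fin 2 → K, v = 0 ∨ ∃ k : Fin 2, ∃ z, z ≠ 0 ∧
      v 0 ^ 2 - u * v 1 ^ 2 = ![1, u] k * z ^ 2 := by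
    intro v
    by_cases hv : v 0 ≠ 0 ∨ v 1 ≠ 0
    · right
      obtain ⟨z, hz0, hz | hz⟩ := D.L1 _ _ hv
      · exact ⟨0, z, hz0, by simp [hz]⟩
      · exact ⟨1, z, hz0, by simp [hz]⟩
    · left
      push Not at hv
      funext i
      fin_cases i <;> simp [hv]
  have hu0 := D.hu0
  have hp0 := D.hp0
  rcases key v with hv | ⟨k, z, hz0, hz⟩ <;> rcases key w with hw | ⟨l, t, ht0, ht⟩
  · simp [hv, hw]
  · exfalso
    have : p * (![1, u] l * t ^ 2) = 0 := by
      rw [← ht]; simp [hv] at h; linear_combination h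
    fin_cases l <;> simp [hp0, hu0, ht0] at this
  · exfalso
    have : ![1, u] k * z ^ 2 = 0 := by
      rw [← hz]; simp [hw] at h; linear_combination h
    fin_cases k <;> simp [hu0, hz0] at this
  · exfalso
    have h3 : ![1, u] k * z ^ 2 + p * (![1, u] l * t ^ 2) = 0 := by
      rw [← hz, ← ht]; linear_combination h
    have h4 : ∃ m n : Fin 4, m.1 < 2 ∧ 2 ≤ n.1 ∧ ∃ r, sqc u p n = sqc u p m * r ^ 2 := by
      obtain ⟨s, hs0, hs⟩ := D.neg1
      have hl : p * ![1, u] l = - ![1, u] k * (z / t) ^ 2 := by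
        field_simp; linear_combination h3
      have hpl : ∃ n : Fin 4, 2 ≤ n.1 ∧ sqc u p n = p * ![1, u] l := by
        fin_cases l
        · exact ⟨2, by simp, by simp [sqc]⟩
        · exact ⟨3, by simp, by simp [sqc]⟩
      obtain ⟨n, hn, hn'⟩ := hpl
      rw [hl] at hn'
      rcases hs with hs | hs <;> fin_cases k <;> simp at hn'
      · exact ⟨0, n, by simp, hn, s * (z / t), by
          rw [hn']; simp [sqc]; linear_combination (z / t) ^ 2 * hs⟩
      · exact ⟨1, n, by simp, hn, s * (z / t), by
          rw [hn']; simp [sqc]; linear_combination u * (z / t) ^ 2 * hs⟩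
      · exact ⟨1, n, by simp, hn, s * (z / t), by
          rw [hn']; simp [sqc]; linear_combination (z / t) ^ 2 * hs⟩
      · exact ⟨0, n, by simp, hn, u * s * (z / t), by
          rw [hn']; simp [sqc]; linear_combination u * (z / t) ^ 2 * hs⟩
    obtain ⟨m, n, hm, hn, r, hr⟩ := h4
    have := sqc_inj D n m r hr
    rw [this] at hn
    omega

end Main


section Final

variable {K : Type} [Field K] {u p : K}

lemma four_rel (D : LocData K u p) {c : K} (hc : c ≠ 0) :
    gcl D.h2 c + gcl D.h2 c = gcl D.h2 (c * u) + gcl D.h2 (c * u) ∧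
    (gcl D.h2 c + gcl D.h2 c = 0 ∨ gcl D.h2 c + gcl D.h2 (c * u) = 0) := by
  have h2 := D.h2
  constructor
  · obtain ⟨r, t, h⟩ := D.sum
    exact gcl_two h2 hc D.hu0 h
  · obtain ⟨s, hs0, hs | hs⟩ := D.neg1
    · left
      have h1 : -c = c * s ^ 2 := by linear_combination c * hs
      have := gcl_neg h2 hc
      rwa [h1, gcl_sq h2 hc hs0] at this
    · right
      have h1 : -c = (c * u) * s ^ 2 := by linear_combination c * hs
      have := gcl_neg h2 hc
      rwa [h1, gcl_sq h2 (mul_ne_zero hc D.hu0) hs0] at this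

/-- The four classes supported on a single residue. -/
def InFour (D : LocData K u p) (c : K) (w : WG K) : Prop :=
  letI := wgGroup D.h2
  w = 0 ∨ w = gcl D.h2 c ∨ w = gcl D.h2 (c * u) ∨ w = gcl D.h2 c - gcl D.h2 (c * u)

lemma wg_decomp (D : LocData K u p) (w : WG K) :
    ∃ w0 w1, InFour D 1 w0 ∧ InFour D p w1 ∧ w = w0 + w1 := by
  have h2 := D.h2
  let _ := wgGroup h2
  have hadd : ∀ a : K, a ≠ 0 → ∀ w : WG K,
      (∃ w0 w1, InFour D 1 w0 ∧ InFour D p w1 ∧ w = w0 + w1) →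
      (∃ w0 w1, InFour D 1 w0 ∧ InFour D p w1 ∧ gcl h2 a + w = w0 + w1) := by
    rintro a ha _ ⟨w0, w1, hw0, hw1, rfl⟩
    have f0 := four_rel D (one_ne_zero (α := K))
    have f1 := four_rel D D.hp0
    obtain ⟨s, hs0, h | h | h | h⟩ := D.cls a ha
    · have e : gcl h2 a = gcl h2 1 := by rw [h, ← gcl_sq h2 one_ne_zero hs0, one_mul]
      refine ⟨w0 + gcl h2 1, w1, (four_closed f0.1 f0.2 hw0).1, hw1, ?_⟩
      rw [e]; abel
    · have e : gcl h2 a = gcl h2 (1 * u) := by rw [h, gcl_sq h2 D.hu0 hs0, one_mul]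
      refine ⟨w0 + gcl h2 (1 * u), w1, (four_closed f0.1 f0.2 hw0).2, hw1, ?_⟩
      rw [e]; abel
    · have e : gcl h2 a = gcl h2 p := by rw [h, gcl_sq h2 D.hp0 hs0]
      refine ⟨w0, w1 + gcl h2 p, hw0, (four_closed f1.1 f1.2 hw1).1, ?_⟩
      rw [e]; abel
    · have e : gcl h2 a = gcl h2 (p * u) := by
        rw [h, gcl_sq h2 (mul_ne_zero D.hu0 D.hp0) hs0, mul_comm]
      refine ⟨w0, w1 + gcl h2 (p * u), hw0, (four_closed f1.1 f1.2 hw1).2, ?_⟩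
      rw [e]; abel
  have hsum : ∀ n (a : Fin n → K), (∀ i, a i ≠ 0) →
      ∃ w0 w1, InFour D 1 w0 ∧ InFour D p w1 ∧ ∑ i, gcl h2 (a i) = w0 + w1 := by
    intro n
    induction n with
    | zero => intro a _; exact ⟨0, 0, Or.inl rfl, Or.inl rfl, by simp⟩
    | succ n ih =>
      intro a ha
      rw [Fin.sum_univ_succ]
      exact hadd _ (ha 0) _ (ih _ fun i => ha _)
  revert w
  rintro ⟨A⟩
  obtain ⟨a, ha, hi⟩ := exists_diag h2 A.Q A.nd
  have hh : ∀ i, QNondeg (oneF (a i)) := fun i => oneF_nondeg h2 (ha i)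
  have e : cls A.Q A.nd = ∑ i, gcl h2 (a i) := by
    rw [cls_eq_of_isom A.nd (QNondeg.pi hh) hi, cls_pi h2 _ hh]
    exact Finset.sum_congr rfl fun i _ => (gcl_of h2 (ha i)).symm
  have := hsum _ a ha
  rw [← e] at this
  exact this

/-- class of the i-th binary form -/
noncomputable def bcl (D : LocData K u p) (i : Fin 7) : WG K :=
  cls (bin (repA u p i) (repB u p i)) (bin_nondeg D.h2 (repA_ne D i) (repB_ne D i))

lemma bcl_eq (D : LocData K u p) (i : Fin 7) :
    bcl D i = gcl D.h2 (repA u p i) + gcl D.h2 (repB u p i) :=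
  cls_bin D.h2 (repA_ne D i) (repB_ne D i) _

/-- the exceptional class -/
noncomputable def omc (D : LocData K u p) : WG K :=
  cls (omF u p) (QNondeg.of_aniso D.h2 (omF_aniso D))

lemma omc_eq (D : LocData K u p) : omc D = bcl D 1 + bcl D 2 := rfl

lemma gcl_neg' (D : LocData K u p) {a : K} (ha : a ≠ 0) :
    letI := wgGroup D.h2
    gcl D.h2 (-a) = - gcl D.h2 a := by
  let _ := wgGroup D.h2
  exact eq_neg_of_add_eq_zero_right (gcl_neg D.h2 ha)

lemma wdim_sub (h2 : (2 : K) ≠ 0) (x y : WG K) :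
    letI := wgGroup h2
    wdim (x - y) = wdim x - wdim y := by
  let _ := wgGroup h2
  rw [eq_sub_iff_add_eq, ← wdim_add, sub_add_cancel]

lemma even_cases (D : LocData K u p) (w : WG K) (hw : wdim w = 0) :
    w = omc D ∨ ∃ i, w = bcl D i := by
  have h2 := D.h2
  let _ := wgGroup h2
  have hu0 := D.hu0
  have hp0 := D.hp0
  have hpu : p * u ≠ 0 := mul_ne_zero hp0 hu0
  have d1 := wdim_gcl h2 (one_ne_zero (α := K))
  have du := wdim_gcl h2 hu0
  have dp := wdim_gcl h2 hp0
  have dpu := wdim_gcl h2 hpu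
  have b0 : bcl D 0 = 0 := by
    rw [bcl_eq]; exact gcl_neg h2 one_ne_zero
  have b1 : bcl D 1 = gcl h2 1 - gcl h2 u := by
    rw [bcl_eq, sub_eq_add_neg, ← gcl_neg' D hu0]; rfl
  have b2 : bcl D 2 = gcl h2 p - gcl h2 (p * u) := by
    rw [bcl_eq, sub_eq_add_neg, ← gcl_neg' D hpu]; rfl
  have h10 : (1 : ZMod 2) ≠ 0 := by decide
  obtain ⟨w0, w1, hw0, hw1, rfl⟩ := wg_decomp D w
  rw [wdim_add] at hw
  simp only [InFour, one_mul] at hw0 hw1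
  rcases hw0 with rfl | rfl | rfl | rfl <;> rcases hw1 with rfl | rfl | rfl | rfl
  · right; exact ⟨0, by rw [b0, add_zero]⟩
  · rw [wdim_zero, dp] at hw; exact absurd hw (by decide)
  · rw [wdim_zero, dpu] at hw; exact absurd hw (by decide)
  · right; exact ⟨2, by rw [b2, zero_add]⟩
  · rw [wdim_zero, d1] at hw; exact absurd hw (by decide)
  · right; exact ⟨3, (bcl_eq D 3).symm⟩
  · right; exact ⟨4, (bcl_eq D 4).symm⟩
  · rw [wdim_sub, d1, dp, dpu] at hw; exact absurd hw (by decide)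
  · rw [wdim_zero, du] at hw; exact absurd hw (by decide)
  · right; exact ⟨5, (bcl_eq D 5).symm⟩
  · right; exact ⟨6, (bcl_eq D 6).symm⟩
  · rw [wdim_sub, du, dp, dpu] at hw; exact absurd hw (by decide)
  · right; exact ⟨1, by rw [b1, add_zero]⟩
  · rw [wdim_sub, d1, dp, du] at hw; exact absurd hw (by decide)
  · rw [wdim_sub, d1, du, dpu] at hw; exact absurd hw (by decide)
  · left; rw [omc_eq, b1, b2]

lemma omc_two (D : LocData K u p) : omc D + omc D = 0 := by
  have h2 := D.h2
  let _ := wgGroup h2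
  have hpu : p * u ≠ 0 := mul_ne_zero D.hp0 D.hu0
  have b1 : bcl D 1 = gcl h2 1 - gcl h2 u := by
    rw [bcl_eq, sub_eq_add_neg, ← gcl_neg' D D.hu0]; rfl
  have b2 : bcl D 2 = gcl h2 p - gcl h2 (p * u) := by
    rw [bcl_eq, sub_eq_add_neg, ← gcl_neg' D hpu]; rfl
  have f0 := (four_rel D (one_ne_zero (α := K))).1
  rw [one_mul] at f0
  have f1 := (four_rel D D.hp0).1
  have e : omc D + omc D = (gcl h2 1 + gcl h2 1 - (gcl h2 u + gcl h2 u)) +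
      (gcl h2 p + gcl h2 p - (gcl h2 (p * u) + gcl h2 (p * u))) := by
    rw [omc_eq, b1, b2]; abel
  rw [e, f0, f1]; abel

/-- isometry classes of nondegenerate binary forms -/
def binSetoid (K : Type) [Field K] : Setoid {Q : QF K 2 // QNondeg Q} where
  r A B := QIsom A.1 B.1
  iseqv := ⟨fun _ => QIsom.refl _, fun h => h.symm, fun h h' => h.trans h'⟩

/-- the Witt class of an isometry class of binary forms -/
noncomputable def iot : Quotient (binSetoid K) → WG K :=
  Quotient.lift (fun A => cls A.1 A.2) (fun A B h => cls_eq_of_isom A.2 B.2 h)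

lemma finrank_om : Module.finrank K ((Fin 2 → K) × (Fin 2 → K)) = 4 := by
  rw [Module.finrank_prod]; simp

lemma main_count (D : LocData K u p) (d : ℕ) (hd : Even d) (Q₀ : QF K d)
    (hQ₀ : QuadraticMap.Anisotropic Q₀) (b : ℕ) :
    (Nat.card (Quot (fun
      (Qt Qt' : {Qt : Fin b → QF K 2 //
        (∀ i, QNondeg (Qt i)) ∧ WittEquiv (QuadraticMap.pi (fun i => Qt i)) Q₀}) =>
      ∀ i, QIsom (Qt.1 i) (Qt'.1 i))) : ℤ) = (7 ^ b - (-1 : ℤ) ^ b) / 8 +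
      (if d = 0 ∧ Even b then (1 : ℤ) else if d = 4 ∧ Odd b then -1 else 0) := by
  classical
  have h2 := D.h2
  let _ := wgGroup h2
  let S := Quotient (binSetoid K)
  have iot_mk : ∀ Q h, iot (Quotient.mk (binSetoid K) ⟨Q, h⟩) = cls Q h := fun _ _ => rfl
  have hinj : Function.Injective (iot (K := K)) := by
    rintro ⟨A⟩ ⟨B⟩ h
    exact Quotient.sound (dim_witt_isom h2 (cls_eq_iff.mp h) rfl)
  let r : Fin 7 → S := fun i => Quotient.mk (binSetoid K)
    ⟨bin (repA u p i) (repB u p i), bin_nondeg D.h2 (repA_ne D i) (repB_ne D i)⟩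
  have hr : ∀ i, iot (r i) = bcl D i := fun i => rfl
  have heven : ∀ s : S, wdim (iot s) = 0 := by
    rintro ⟨A⟩
    change ((Module.finrank K (Fin 2 → K) : ℕ) : ZMod 2) = 0
    rw [Module.finrank_fin_fun]; decide
  have hne : ∀ s : S, iot s ≠ omc D := by
    rintro ⟨A⟩ h
    exact no_binary h2 (omF_aniso D) finrank_om A.2 (cls_eq_iff.mp h).symm
  have hrb : Function.Bijective r := by
    constructor
    · intro i j h
      exact rep_inj D i j (Quotient.exact h)
    · intro s
      rcases even_cases D (iot s) (heven s) with h | ⟨i, h⟩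
      · exact absurd h (hne s)
      · exact ⟨i, hinj (by rw [hr, h])⟩
  have hfin : Finite S := Finite.of_surjective r hrb.2
  have hS : Nat.card S = 7 := by
    rw [← Nat.card_eq_of_bijective r hrb]; simp
  let H : AddSubgroup (WG K) :=
    { carrier := {w | wdim w = 0}
      add_mem' := fun {x y} hx hy => by
        simp only [Set.mem_setOf_eq] at *
        rw [wdim_add, hx, hy, add_zero]
      zero_mem' := wdim_zero
      neg_mem' := fun {x} hx => by
        simp only [Set.mem_setOf_eq] at *
        rw [← zero_sub x, wdim_sub h2, wdim_zero, hx, sub_zero] }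
  have hωH : omc D ∈ H := by
    change wdim (omc D) = 0
    rw [omc, wdim_cls, finrank_om]; decide
  have hsurj : ∀ g ∈ H, g ≠ omc D → ∃ s : S, iot s = g := by
    intro g hg hgne
    rcases even_cases D g hg with h | ⟨i, h⟩
    · exact absurd h hgne
    · exact ⟨r i, by rw [hr, h]⟩
  have hQn : QNondeg Q₀ := QNondeg.of_aniso h2 hQ₀
  have hqH : cls Q₀ hQn ∈ H := by
    change wdim _ = 0
    rw [wdim_cls, Module.finrank_fin_fun]
    obtain ⟨k, rfl⟩ := hd
    push_cast
    exact CharTwo.add_self_eq_zero _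
  have key := tuple_count hS iot H (omc D) hωH heven hne hinj hsurj b (cls Q₀ hQn) hqH
  -- the two counts agree
  have hcard : Nat.card (Quot (fun
      (Qt Qt' : {Qt : Fin b → QF K 2 //
        (∀ i, QNondeg (Qt i)) ∧ WittEquiv (QuadraticMap.pi (fun i => Qt i)) Q₀}) =>
      ∀ i, QIsom (Qt.1 i) (Qt'.1 i))) =
      Nat.card {c : Fin b → S // ∑ i, iot (c i) = cls Q₀ hQn} := by
    let f : Quot (fun
      (Qt Qt' : {Qt : Fin b → QF K 2 //
        (∀ i, QNondeg (Qt i)) ∧ WittEquiv (QuadraticMap.pi (fun i => Qt i)) Q₀}) =>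
      ∀ i, QIsom (Qt.1 i) (Qt'.1 i)) → {c : Fin b → S // ∑ i, iot (c i) = cls Q₀ hQn} :=
      Quot.lift (fun Qt => ⟨fun i => Quotient.mk (binSetoid K) ⟨Qt.1 i, Qt.2.1 i⟩, by
        have := cls_pi h2 Qt.1 Qt.2.1
        refine Eq.trans ?_ (this.symm.trans (cls_eq_iff.mpr Qt.2.2))
        rfl⟩) (by
        intro Qt Qt' h
        apply Subtype.ext
        funext i
        exact Quotient.sound (h i))
    refine Nat.card_eq_of_bijective f ⟨?_, ?_⟩
    · rintro ⟨Qt⟩ ⟨Qt'⟩ h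
      apply Quot.sound
      intro i
      exact Quotient.exact (congrFun (congrArg Subtype.val h) i)
    · rintro ⟨c, hc⟩
      have hout : ∀ i, Quotient.mk (binSetoid K) (c i).out = c i := fun i => Quotient.out_eq _
      have hc' : ∑ i, cls (c i).out.1 (c i).out.2 = cls Q₀ hQn := by
        rw [← hc]
        refine Finset.sum_congr rfl fun i _ => ?_
        conv_rhs => rw [← hout i]
        rfl
      rw [← cls_pi h2] at hc'
      refine ⟨Quot.mk _ ⟨fun i => (c i).out.1, fun i => (c i).out.2, cls_eq_iff.mp hc'⟩, ?_⟩
      apply Subtype.ext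
      funext i
      exact hout i
  rw [hcard]
  -- identification of the class of Q₀
  have hz : cls Q₀ hQn = 0 ↔ d = 0 := by
    constructor
    · intro h
      have hz0 : (0 : QuadraticForm K (Fin 0 → K)).Anisotropic := fun x _ => Subsingleton.elim _ _
      have := (aniso_witt_isom h2 (cls_eq_iff.mp h) hQ₀ hz0).finrank
      simpa using this
    · rintro rfl
      exact cls_unit _ _
  have hω : cls Q₀ hQn = omc D ↔ d = 4 := by
    constructor
    · intro h
      have := (aniso_witt_isom h2 (cls_eq_iff.mp h) hQ₀ (omF_aniso D)).finrank
      rw [finrank_om] at this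
      simpa using this
    · intro h
      rcases even_cases D _ hqH with h' | ⟨i, h'⟩
      · exact h'
      · exact absurd (cls_eq_iff.mp h') (no_binary h2 hQ₀ (by simp [h])
          (bin_nondeg D.h2 (repA_ne D i) (repB_ne D i)))
  have hdouble : 2 • omc D = 0 := by rw [two_nsmul]; exact omc_two D
  rcases Nat.even_or_odd b with hb | hb
  · have hbω : b • omc D = 0 := by
      obtain ⟨k, rfl⟩ := hb
      rw [← two_mul, mul_nsmul, hdouble, nsmul_zero]
    have hno : ¬ Odd b := Nat.not_odd_iff_even.mpr hb
    simp only [hbω, hz, hb.neg_one_pow] at key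
    simp only [hb, hno, and_true, and_false, if_false, hb.neg_one_pow]
    split_ifs at key ⊢ <;> omega
  · have hbω : b • omc D = omc D := by
      obtain ⟨k, rfl⟩ := hb
      rw [add_nsmul, mul_nsmul, hdouble, nsmul_zero, one_nsmul, zero_add]
    have hno : ¬ Even b := Nat.not_even_iff_odd.mpr hb
    simp only [hbω, hω, hb.neg_one_pow] at key
    simp only [hb, hno, and_true, and_false, if_false, hb.neg_one_pow]
    split_ifs at key ⊢ <;> omega

end Final

/-- Lemma (count of `b`-tuples of isometry classes of degree-two forms representing an
anisotropic class of even degree `d`). -/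
theorem statement_8 (p : ℕ) [Fact p.Prime] (hp : p ≠ 2) (K : Type) [Field K]
    [Algebra ℚ_[p] K] [FiniteDimensional ℚ_[p] K]
    (d : ℕ) (hd : Even d) (Q₀ : QF K d) (hQ₀ : QuadraticMap.Anisotropic Q₀)
    (b : ℕ)
    (N : ℕ)
    (hN : N = Nat.card (Quot (fun
      (Qt Qt' : {Qt : Fin b → QF K 2 //
        (∀ i, QNondeg (Qt i)) ∧ WittEquiv (QuadraticMap.pi (fun i => Qt i)) Q₀}) =>
      ∀ i, QIsom (Qt.1 i) (Qt'.1 i)))) :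
    (N : ℤ) = (7 ^ b - (-1 : ℤ) ^ b) / 8 +
      (if d = 0 ∧ Even b then (1 : ℤ) else if d = 4 ∧ Odd b then -1 else 0) := by
  obtain ⟨u, π, D⟩ := locData_exists p hp K
  rw [hN]
  exact main_count D d hd Q₀ hQ₀ b
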